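/- arXiv:2107.06980 — 12 statements merged into one kernel-verified Lean document; each statement's English description precedes it below -/
import Mathlib

section
/- Define β*_j = (N/t)·(1 − 1/(t·f))^{j−1} for 1 ≤ j ≤ s+1, and β*_j = (N/t)·(1 − 1/(t·f))^{s}·(1 − 1/(q·t·f))^{j−s−1} for s+1 < j ≤ t. Then β* is feasible for the binary LP, and for every feasible vector β one has Φ(β*) ≤ Φ(β); that is, β* is an optimal (minimizing) solution of the binary LP. (Claim 2.2) -/
/-- Feasibility for the binary LP: `β j ≥ 0` on `{1,…,t}`, `β 1 = N/t`, and the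
two families of constraints (below and above the threshold index `s`). -/
def binFeasible (t s : ℕ) (N f q : ℝ) (β : ℕ → ℝ) : Prop :=
  (∀ j, 1 ≤ j → j ≤ t → 0 ≤ β j) ∧
  β 1 = N / t ∧
  (∀ j, 1 ≤ j → j ≤ min s (t - 1) →
    f * t * (β 1 - β (j + 1)) ≤ ∑ ℓ ∈ Finset.Icc 1 j, β ℓ) ∧
  (∀ j, s < j → j ≤ t - 1 →
    f * t * (β 1 - β (j + 1)) ≤
      (∑ ℓ ∈ Finset.Icc 1 s, β ℓ) + (1 / q) * ∑ ℓ ∈ Finset.Icc (s + 1) j, β ℓ)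

/-- The objective `Φ` of the binary LP. -/
noncomputable def binObj (t s : ℕ) (N f q r c : ℝ) (β : ℕ → ℝ) : ℝ :=
  N * f * (1 - q) * r - N * c + (c - (1 - q) * r) * (∑ j ∈ Finset.Icc 1 s, β j)
    + c * ∑ j ∈ Finset.Icc (s + 1) t, β j

/-- The candidate optimal solution `β*` of the binary LP. -/
noncomputable def binBetaStar (t s : ℕ) (N f q : ℝ) (j : ℕ) : ℝ :=
  if j ≤ s + 1 then (N / t) * (1 - 1 / (t * f)) ^ (j - 1)
  else (N / t) * (1 - 1 / (t * f)) ^ s * (1 - 1 / (q * t * f)) ^ (j - s - 1)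

/-- The sum of `β` over `{1,…,j}` in which the entries beyond the threshold `s` carry weight
`1 / q`. -/
noncomputable def weightedSum (s : ℕ) (q : ℝ) (β : ℕ → ℝ) (j : ℕ) : ℝ :=
  (∑ ℓ ∈ Finset.Icc 1 (min s j), β ℓ) + (1 / q) * ∑ ℓ ∈ Finset.Icc (s + 1) j, β ℓ

theorem weightedSum_zero (s : ℕ) (q : ℝ) (β : ℕ → ℝ) : weightedSum s q β 0 = 0 := by
  simp [weightedSum]

theorem weightedSum_of_le {s j : ℕ} (h : j ≤ s) (q : ℝ) (β : ℕ → ℝ) :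
    weightedSum s q β j = ∑ ℓ ∈ Finset.Icc 1 j, β ℓ := by
  rw [weightedSum, min_eq_right h, Finset.Icc_eq_empty (by lia : ¬ s + 1 ≤ j)]
  simp

theorem weightedSum_of_ge {s j : ℕ} (h : s ≤ j) (q : ℝ) (β : ℕ → ℝ) :
    weightedSum s q β j =
      (∑ ℓ ∈ Finset.Icc 1 s, β ℓ) + (1 / q) * ∑ ℓ ∈ Finset.Icc (s + 1) j, β ℓ := by
  rw [weightedSum, min_eq_left h]

theorem weightedSum_succ (s : ℕ) (q : ℝ) (β : ℕ → ℝ) (j : ℕ) :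
    weightedSum s q β (j + 1) =
      weightedSum s q β j + (if j + 1 ≤ s then 1 else 1 / q) * β (j + 1) := by
  split_ifs with h
  · rw [weightedSum_of_le h, weightedSum_of_le (by lia : j ≤ s),
      Finset.sum_Icc_succ_top (by lia), one_mul]
  · rw [weightedSum_of_ge (by lia : s ≤ j + 1), weightedSum_of_ge (by lia : s ≤ j),
      Finset.sum_Icc_succ_top (by lia)]
    ring

theorem binFeasible_iff (t s : ℕ) (N f q : ℝ) (β : ℕ → ℝ) :
    binFeasible t s N f q β ↔
      (∀ j, 1 ≤ j → j ≤ t → 0 ≤ β j) ∧ β 1 = N / t ∧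
      ∀ j, j + 1 ≤ t → f * t * (β 1 - β (j + 1)) ≤ weightedSum s q β j := by
  refine and_congr_right fun _ => and_congr_right fun _ => ⟨fun ⟨hle, hgt⟩ j hj => ?_, fun h => ?_⟩
  · rcases Nat.eq_zero_or_pos j with rfl | hpos
    · simp [weightedSum_zero]
    rcases le_or_gt j s with hjs | hjs
    · rw [weightedSum_of_le hjs]
      exact hle j hpos (by lia)
    · rw [weightedSum_of_ge hjs.le]
      exact hgt j hjs (by lia)
  · refine ⟨fun j hpos hj => ?_, fun j hjs hj => ?_⟩
    · rw [← weightedSum_of_le (by lia : j ≤ s) q]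
      exact h j (by lia)
    · rw [← weightedSum_of_ge hjs.le q]
      exact h j (by lia)

theorem binObj_eq_weightedSum {t s : ℕ} (hs : s ≤ t) (N f r c : ℝ) {q : ℝ} (hq : q ≠ 0)
    (β : ℕ → ℝ) :
    binObj t s N f q r c β = N * f * (1 - q) * r - N * c +
      (1 - q) * (c - r) * weightedSum s q β s + c * q * weightedSum s q β t := by
  rw [weightedSum_of_le le_rfl, weightedSum_of_ge hs, binObj]
  field_simp
  ring

theorem binBetaStar_one (t s : ℕ) (N f q : ℝ) : binBetaStar t s N f q 1 = N / t := by
  simp [binBetaStar]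

theorem binBetaStar_succ_succ (t s : ℕ) (N f q : ℝ) (j : ℕ) :
    binBetaStar t s N f q (j + 2) =
      (1 - (if j + 1 ≤ s then 1 else 1 / q) / (f * t)) * binBetaStar t s N f q (j + 1) := by
  have hdiv : 1 / q / (f * t) = 1 / (q * t * f) := by rw [div_div]; ring_nf
  unfold binBetaStar
  rcases lt_trichotomy j s with h | rfl | h
  · rw [if_pos (by lia), if_pos (by lia), if_pos (by lia), show j + 2 - 1 = j + 1 by lia,
      Nat.add_sub_cancel, pow_succ, mul_comm f]
    ring
  · rw [if_neg (by lia), if_neg (by lia), if_pos le_rfl, show j + 2 - j - 1 = 1 by lia,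
      Nat.add_sub_cancel, hdiv]
    ring
  · rw [if_neg (by lia), if_neg (by lia), if_neg (by lia),
      show j + 2 - s - 1 = (j + 1 - s - 1) + 1 by lia, pow_succ, hdiv]
    ring

theorem binBetaStar_tight (t s : ℕ) (N q : ℝ) {f : ℝ} (hft : f * t ≠ 0) (j : ℕ) :
    f * t * (binBetaStar t s N f q 1 - binBetaStar t s N f q (j + 1)) =
      weightedSum s q (binBetaStar t s N f q) j := by
  induction j with
  | zero => simp [weightedSum_zero]
  | succ j ih =>
    rw [weightedSum_succ, ← ih, binBetaStar_succ_succ, one_sub_mul]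
    generalize (if j + 1 ≤ s then (1 : ℝ) else 1 / q) = w
    linear_combination binBetaStar t s N f q (j + 1) * mul_div_cancel₀ w hft

theorem binBetaStar_nonneg {t s : ℕ} {N f q : ℝ} (hN : 0 ≤ N) (htf : 1 ≤ t * f)
    (hqtf : 1 ≤ q * t * f) (j : ℕ) : 0 ≤ binBetaStar t s N f q j := by
  have h₁ : 0 ≤ 1 - 1 / (t * f) := sub_nonneg.2 (div_le_one_of_le₀ htf (by linarith))
  have h₂ : 0 ≤ 1 - 1 / (q * t * f) := sub_nonneg.2 (div_le_one_of_le₀ hqtf (by linarith))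
  unfold binBetaStar
  split_ifs <;> positivity

theorem weightedSum_binBetaStar_le {t s : ℕ} {N f q : ℝ} (hq : 0 < q) (htf : 1 ≤ f * t)
    (hqtf : 1 ≤ q * (f * t)) {β : ℕ → ℝ} (hβ : binFeasible t s N f q β) {j : ℕ} (hj : j ≤ t) :
    weightedSum s q (binBetaStar t s N f q) j ≤ weightedSum s q β j := by
  obtain ⟨-, hβ₁, hβ⟩ := (binFeasible_iff t s N f q β).1 hβ
  have hpos : 0 < f * t := by linarith
  induction j with
  | zero => simp [weightedSum_zero]
  | succ j ih =>
    specialize ih (by lia)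
    have hw : 0 ≤ (if j + 1 ≤ s then (1 : ℝ) else 1 / q) ∧
        (if j + 1 ≤ s then (1 : ℝ) else 1 / q) ≤ f * t := by
      split_ifs
      · exact ⟨zero_le_one, htf⟩
      · exact ⟨by positivity, (div_le_iff₀' hq).2 hqtf⟩
    rw [weightedSum_succ, weightedSum_succ]
    generalize (if j + 1 ≤ s then (1 : ℝ) else 1 / q) = w at hw
    have hstar := binBetaStar_tight t s N q hpos.ne' j
    rw [binBetaStar_one] at hstar
    have hle := hβ j hj
    rw [hβ₁] at hle
    refine le_of_mul_le_mul_left ?_ hpos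
    have h₁ := mul_nonneg (sub_nonneg.2 hw.2) (sub_nonneg.2 ih)
    have h₂ := mul_nonneg hw.1 (sub_nonneg.2 hle)
    linear_combination h₁ + h₂ - w * hstar

/-- Claim 2.2: `β*` is feasible for the binary LP and minimizes the objective `Φ`
over all feasible vectors. -/
theorem binary_lp_optimal (t s : ℕ) (N f q r c : ℝ)
    (ht : 1 ≤ t) (hs : s ≤ t) (hN : 0 < N) (hf : 1 ≤ f)
    (hq0 : 0 < q) (hq1 : q < 1) (hr : 0 < r) (hrc : r ≤ c)
    (hqtf : 1 ≤ q * t * f) :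
    binFeasible t s N f q (binBetaStar t s N f q) ∧
    ∀ β : ℕ → ℝ, binFeasible t s N f q β →
      binObj t s N f q r c (binBetaStar t s N f q) ≤ binObj t s N f q r c β := by
  have ht' : (1 : ℝ) ≤ t := by exact_mod_cast ht
  have htf : 1 ≤ f * t := one_le_mul_of_one_le_of_one_le hf ht'
  refine ⟨(binFeasible_iff ..).2 ⟨fun j _ _ => binBetaStar_nonneg hN.le (by linarith) hqtf j,
    binBetaStar_one .., fun j _ => (binBetaStar_tight t s N q (by linarith) j).le⟩,
    fun β hβ => ?_⟩
  have hle {j : ℕ} (hj : j ≤ t) :=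
    weightedSum_binBetaStar_le hq0 htf (by linarith) hβ hj
  rw [binObj_eq_weightedSum hs _ _ _ _ hq0.ne', binObj_eq_weightedSum hs _ _ _ _ hq0.ne']
  have h₁ : 0 ≤ (1 - q) * (c - r) := mul_nonneg (by linarith) (by linarith)
  have h₂ : 0 ≤ c * q := mul_nonneg (by linarith) hq0.le
  gcongr
  · exact hle hs
  · exact hle le_rfl
end

section
/- Let x* := q·ln(1 − r/c) + 1/f. Then x* < 1/f, and if x* ≥ 0 then: (a) for every x ∈ [0, 1/f], RHS(x) ≤ RHS(x*), and (b) RHS(x*) = N·c·f·((1 − 1/f) − (1 − r/c)^{1−q}·e^{−1/f}). (Claim 2.3, interior case) -/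
/-- The lower-bound function `RHS(x)` on the reward of Algorithm 2 for a binary
AdEx reward distribution with parameters `q`, `r`, penalty `c`, supply factor `f`. -/
noncomputable def RHSfun (N c f q r : ℝ) (x : ℝ) : ℝ :=
  N * c * (f - 1) + (1 - q) * (r - c) * f * N * Real.exp (-x)
    - q * f * N * c * Real.exp (((1 - q) / q) * x - 1 / (q * f))

/-- `RHSfun` written through a weighted sum of exponentials, with `1 - r / c` absorbed
into the exponent. -/
theorem RHSfun_eq_weighted_exp {c r : ℝ} (N f q : ℝ) (hc : 0 < c) (hrc : r < c) (x : ℝ) :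
    RHSfun N c f q r x = N * c * (f - 1) - N * c * f *
      ((1 - q) * Real.exp (Real.log (1 - r / c) - x)
        + q * Real.exp (((1 - q) / q) * x - 1 / (q * f))) := by
  have hu : 0 < 1 - r / c := sub_pos.2 ((div_lt_one hc).2 hrc)
  have hcu : r - c = -(c * (1 - r / c)) := by field_simp; ring
  rw [RHSfun, sub_eq_add_neg (Real.log _) x, Real.exp_add, Real.exp_log hu, hcu]
  ring

/-- Weighted arithmetic-geometric mean inequality for two exponentials. -/
theorem exp_weighted_le {q : ℝ} (hq0 : 0 ≤ q) (hq1 : q ≤ 1) (a b : ℝ) :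
    Real.exp ((1 - q) * a + q * b) ≤ (1 - q) * Real.exp a + q * Real.exp b :=
  convexOn_exp.2 (Set.mem_univ a) (Set.mem_univ b) (sub_nonneg.2 hq1) hq0 (by ring)

/-- Claim 2.3, interior case: with `x* = q·ln(1 − r/c) + 1/f`, we have `x* < 1/f`,
and if `x* ≥ 0` then `RHS` is maximized over `[0, 1/f]` at `x*`, where it takes the
value `N·c·f·((1 − 1/f) − (1 − r/c)^{1−q}·e^{−1/f})`. -/
theorem rhs_max_interior (N c f q r : ℝ) (hN : 0 < N) (hc : 0 < c) (hf : 1 ≤ f)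
    (hq0 : 0 < q) (hq1 : q < 1) (hr : 0 < r) (hrc : r < c) :
    q * Real.log (1 - r / c) + 1 / f < 1 / f ∧
    (0 ≤ q * Real.log (1 - r / c) + 1 / f →
      (∀ x ∈ Set.Icc (0 : ℝ) (1 / f),
        RHSfun N c f q r x ≤ RHSfun N c f q r (q * Real.log (1 - r / c) + 1 / f)) ∧
      RHSfun N c f q r (q * Real.log (1 - r / c) + 1 / f)
        = N * c * f * ((1 - 1 / f) - (1 - r / c) ^ (1 - q) * Real.exp (-1 / f))) := by
  have hf0 : 0 < f := one_pos.trans_le hf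
  have hu : 0 < 1 - r / c := sub_pos.2 ((div_lt_one hc).2 hrc)
  have hlog : Real.log (1 - r / c) < 0 :=
    Real.log_neg hu (sub_lt_self 1 (div_pos hr hc))
  have hvalue : RHSfun N c f q r (q * Real.log (1 - r / c) + 1 / f) =
      N * c * (f - 1) - N * c * f * Real.exp ((1 - q) * Real.log (1 - r / c) - 1 / f) := by
    rw [RHSfun_eq_weighted_exp N f q hc hrc]
    generalize Real.log (1 - r / c) = L
    have h₁ : L - (q * L + 1 / f) = (1 - q) * L - 1 / f := by ring
    have h₂ : (1 - q) / q * (q * L + 1 / f) - 1 / (q * f) = (1 - q) * L - 1 / f := by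
      field_simp
      ring
    rw [h₁, h₂]
    ring
  refine ⟨by linarith [mul_neg_of_pos_of_neg hq0 hlog], fun _ => ⟨fun x _ => ?_, ?_⟩⟩
  · rw [hvalue, RHSfun_eq_weighted_exp N f q hc hrc]
    have h := exp_weighted_le hq0.le hq1.le (Real.log (1 - r / c) - x)
      ((1 - q) / q * x - 1 / (q * f))
    have hmean : (1 - q) * (Real.log (1 - r / c) - x) + q * ((1 - q) / q * x - 1 / (q * f))
        = (1 - q) * Real.log (1 - r / c) - 1 / f := by
      field_simp
      ring
    rw [hmean] at h
    gcongr
  · rw [hvalue, Real.rpow_def_of_pos hu, ← Real.exp_add,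
      show Real.log (1 - r / c) * (1 - q) + -1 / f
        = (1 - q) * Real.log (1 - r / c) - 1 / f by ring]
    field_simp
end

section
/- Let x* := q·ln(1 − r/c) + 1/f. If x* < 0, then for every x ∈ [0, 1/f] one has RHS(x) ≤ RHS(0), i.e., on the interval [0, 1/f] the function RHS is maximized at the boundary point 0. (Claim 2.3, boundary case) -/
/-- Claim 2.3, boundary case: if `x* = q·ln(1 − r/c) + 1/f < 0`, then `RHS` is
maximized over `[0, 1/f]` at the boundary point `0`. -/
theorem rhs_max_boundary (N c f q r : ℝ) (hN : 0 < N) (hc : 0 < c) (hf : 1 ≤ f)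
    (hq0 : 0 < q) (hq1 : q < 1) (hr : 0 < r) (hrc : r < c)
    (hneg : q * Real.log (1 - r / c) + 1 / f < 0) :
    ∀ x ∈ Set.Icc (0 : ℝ) (1 / f), RHSfun N c f q r x ≤ RHSfun N c f q r 0 := by
  rintro x ⟨hx, -⟩
  have hf0 : 0 < f := by linarith
  have hpos : 0 < 1 - r / c := by rw [sub_pos, div_lt_one hc]; exact hrc
  have hlog : Real.log (1 - r / c) < -(1 / (q * f)) := by
    have h : q * Real.log (1 - r / c) < q * -(1 / (q * f)) := by
      have h' : q * -(1 / (q * f)) = -(1 / f) := by field_simp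
      linarith
    exact lt_of_mul_lt_mul_left h hq0.le
  have hE : c - r ≤ c * Real.exp (-(1 / (q * f))) := by
    have h := ((Real.log_lt_iff_lt_exp hpos).1 hlog).le
    have h' : c - r = c * (1 - r / c) := by field_simp
    rw [h']
    gcongr
  have hexp : Real.exp ((1 - q) / q * x - 1 / (q * f)) =
      Real.exp ((1 - q) / q * x) * Real.exp (-(1 / (q * f))) := by
    rw [← Real.exp_add, sub_eq_add_neg]
  have hdec : 1 - Real.exp (-x) ≤ x := by linarith [Real.add_one_le_exp (-x)]
  have hinc : (1 - q) * x ≤ q * (Real.exp ((1 - q) / q * x) - 1) := by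
    have h : (1 - q) * x = q * ((1 - q) / q * x) := by field_simp
    rw [h]
    gcongr
    linarith [Real.add_one_le_exp ((1 - q) / q * x)]
  simp only [RHSfun, hexp, mul_zero, neg_zero, Real.exp_zero, mul_one, zero_sub]
  generalize Real.exp (-(1 / (q * f))) = E at *
  generalize Real.exp ((1 - q) / q * x) = A at *
  generalize Real.exp (-x) = B at *
  have hcE : 0 ≤ c * E := by linarith
  have hq : 0 ≤ 1 - q := by linarith
  have key : (1 - q) * (c - r) * (1 - B) ≤ c * E * (q * (A - 1)) :=
    calc (1 - q) * (c - r) * (1 - B) ≤ (1 - q) * (c - r) * x :=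
          mul_le_mul_of_nonneg_left hdec (mul_nonneg hq (by linarith))
      _ ≤ (1 - q) * (c * E) * x := by gcongr
      _ = c * E * ((1 - q) * x) := by ring
      _ ≤ c * E * (q * (A - 1)) := mul_le_mul_of_nonneg_left hinc hcE
  have hfN : 0 ≤ f * N := by positivity
  linear_combination mul_le_mul_of_nonneg_left key hfN
end

section
/- The function RHS is strictly concave on ℝ, its derivative is RHS'(x) = (1−q)·(c−r)·f·N·e^{−x} − (1−q)·f·N·c·e^{((1−q)/q)·x − 1/(q·f)}, and RHS'(x) = 0 holds if and only if x = x* := q·ln(1 − r/c) + 1/f; in particular x* is the unique critical point of RHS. (Analysis of RHS in the proof of Claim 2.3) -/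
theorem hasDerivAt_RHSfun (N c f r : ℝ) {q : ℝ} (hq : q ≠ 0) (x : ℝ) :
    HasDerivAt (RHSfun N c f q r)
      ((1 - q) * (c - r) * f * N * Real.exp (-x)
        - (1 - q) * f * N * c * Real.exp (((1 - q) / q) * x - 1 / (q * f))) x := by
  have h₁ : HasDerivAt (fun y : ℝ => Real.exp (-y)) (Real.exp (-x) * -1) x :=
    (hasDerivAt_id x).neg.exp
  have h₂ : HasDerivAt (fun y : ℝ => Real.exp (((1 - q) / q) * y - 1 / (q * f)))
      (Real.exp (((1 - q) / q) * x - 1 / (q * f)) * (((1 - q) / q) * 1)) x :=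
    (((hasDerivAt_id x).const_mul ((1 - q) / q)).sub_const (1 / (q * f))).exp
  have h := ((h₁.const_mul ((1 - q) * (r - c) * f * N)).const_add (N * c * (f - 1))).sub
    (h₂.const_mul (q * f * N * c))
  refine h.congr_deriv ?_
  have hqq : q * ((1 - q) / q) = 1 - q := mul_div_cancel₀ _ hq
  linear_combination
    (-(f * N * c * Real.exp (((1 - q) / q) * x - 1 / (q * f)))) * hqq

/-- Analysis of `RHS` in the proof of Claim 2.3: `RHS` is strictly concave on `ℝ`,
its derivative is `RHS'(x) = (1−q)(c−r)fN e^{−x} − (1−q)fNc e^{((1−q)/q)x − 1/(qf)}`,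
and `RHS'(x) = 0` iff `x = x* = q·ln(1 − r/c) + 1/f`. -/
theorem rhs_concave_deriv (N c f q r : ℝ) (hN : 0 < N) (hc : 0 < c) (hf : 1 ≤ f)
    (hq0 : 0 < q) (hq1 : q < 1) (hr : 0 < r) (hrc : r < c) :
    StrictConcaveOn ℝ Set.univ (RHSfun N c f q r) ∧
    (∀ x : ℝ, HasDerivAt (RHSfun N c f q r)
      ((1 - q) * (c - r) * f * N * Real.exp (-x)
        - (1 - q) * f * N * c * Real.exp (((1 - q) / q) * x - 1 / (q * f))) x) ∧
    (∀ x : ℝ,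
      (1 - q) * (c - r) * f * N * Real.exp (-x)
        - (1 - q) * f * N * c * Real.exp (((1 - q) / q) * x - 1 / (q * f)) = 0 ↔
      x = q * Real.log (1 - r / c) + 1 / f) := by
  have hf0 : 0 < f := one_pos.trans_le hf
  have hq1' : 0 < 1 - q := sub_pos.2 hq1
  have hcr : 0 < c - r := sub_pos.2 hrc
  have hderiv := hasDerivAt_RHSfun N c f r hq0.ne'
  refine ⟨?_, hderiv, fun x => ?_⟩
  · refine StrictAnti.strictConcaveOn_univ_of_deriv
      (continuous_iff_continuousAt.2 fun x => (hderiv x).continuousAt) fun x y hxy => ?_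
    rw [(hderiv x).deriv, (hderiv y).deriv]
    have hq : 0 < (1 - q) / q := div_pos hq1' hq0
    gcongr
  · have hpos : 0 < 1 - r / c := sub_pos.2 ((div_lt_one hc).2 hrc)
    have hexp : (1 - q) * (c - r) * f * N * Real.exp (-x) =
        (1 - q) * f * N * c * Real.exp (Real.log (1 - r / c) + -x) := by
      rw [Real.exp_add, Real.exp_log hpos]
      field_simp
    have hK : (1 - q) * f * N * c ≠ 0 := by positivity
    rw [hexp, sub_eq_zero, mul_right_inj' hK, Real.exp_eq_exp]
    have hx : Real.log (1 - r / c) + -x - ((1 - q) / q * x - 1 / (q * f)) =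
        (q * Real.log (1 - r / c) + 1 / f - x) / q := by
      field_simp
      ring
    rw [← sub_eq_zero, hx, div_eq_zero_iff, or_iff_left hq0.ne', sub_eq_zero, eq_comm]
end

section
/- The linear function G attains its maximum on the (compact) feasible set Y, and every maximizer y of G over Y admits integer thresholds 1 ≤ z_2 ≤ z_1 ≤ m such that for u = 1, 2: y_{i,u} = 1/(m−i+1) for all i < z_u and y_{i,u} = 0 for all i > z_u. (Lemma 2.7) -/
/-- The feasible set `Y` of the adversary LP for a binary AdEx distribution:
`0 ≤ y_{i,u} ≤ 1/(m−i+1)` for `i ∈ {1,…,m}`, `u ∈ {1,2}`, together with the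
capacity constraint on advertiser `π⁻¹(m)`. -/
def binYset (m : ℕ) (N f q : ℝ) : Set (ℕ → ℕ → ℝ) :=
  {y | (∀ i, 1 ≤ i → i ≤ m → ∀ u, 1 ≤ u → u ≤ 2 →
          0 ≤ y i u ∧ y i u ≤ 1 / ((m : ℝ) - i + 1)) ∧
       ∑ i ∈ Finset.Icc 1 m, (f * N / m) * (q * y i 1 + (1 - q) * y i 2) ≤ N / m}

/-- The objective `G` of the adversary LP for a binary AdEx distribution. -/
noncomputable def binGfun (m : ℕ) (N f q r c : ℝ) (y : ℕ → ℕ → ℝ) : ℝ :=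
  -c * N + f * N * (1 - q) * r +
    ∑ i ∈ Finset.Icc 1 m,
      ((m : ℝ) - i + 1) * (f * N / m) * (q * c * y i 1 + (1 - q) * (c - r) * y i 2)

/-- Adding mass `δ` to the coordinate `(i, u)` changes a weighted sum by the weight times `δ`. -/
theorem sum_add_single_single {m : ℕ} (a : ℕ → ℝ) (p p' δ : ℝ) (y : ℕ → ℕ → ℝ) {i u : ℕ}
    (hi : i ∈ Finset.Icc 1 m) (hu : u = 1 ∨ u = 2) :
    ∑ k ∈ Finset.Icc 1 m, a k * (p * (y + Pi.single i (Pi.single u δ) : ℕ → ℕ → ℝ) k 1 +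
        p' * (y + Pi.single i (Pi.single u δ) : ℕ → ℕ → ℝ) k 2) =
      ∑ k ∈ Finset.Icc 1 m, a k * (p * y k 1 + p' * y k 2) +
        a i * ((if u = 1 then p else p') * δ) := by
  have h : ∑ k ∈ Finset.Icc 1 m, a k * (p * (Pi.single i (Pi.single u δ) : ℕ → ℕ → ℝ) k 1 +
      p' * (Pi.single i (Pi.single u δ) : ℕ → ℕ → ℝ) k 2) =
        a i * ((if u = 1 then p else p') * δ) := by
    rw [Finset.sum_eq_single_of_mem i hi]
    · rcases hu with rfl | rfl <;> simp
    · intro k _ hk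
      simp [Pi.single_eq_of_ne hk]
  rw [← h, ← Finset.sum_add_distrib]
  refine Finset.sum_congr rfl fun k _ => ?_
  simp only [Pi.add_apply]
  ring

theorem exists_isMaxOn_binYset (m : ℕ) {N f q r c : ℝ} (hN : 0 < N) :
    ∃ y ∈ binYset m N f q, ∀ y' ∈ binYset m N f q,
      binGfun m N f q r c y' ≤ binGfun m N f q r c y := by
  classical
  let box : ℕ → ℕ → Set ℝ := fun i u =>
    if (1 ≤ i ∧ i ≤ m) ∧ 1 ≤ u ∧ u ≤ 2 then Set.Icc 0 (1 / ((m : ℝ) - i + 1)) else {0}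
  let trunc : (ℕ → ℕ → ℝ) → ℕ → ℕ → ℝ := fun y i u =>
    if (1 ≤ i ∧ i ≤ m) ∧ 1 ≤ u ∧ u ≤ 2 then y i u else 0
  let load : (ℕ → ℕ → ℝ) → ℝ := fun y =>
    ∑ i ∈ Finset.Icc 1 m, (f * N / m) * (q * y i 1 + (1 - q) * y i 2)
  let K : Set (ℕ → ℕ → ℝ) := Set.univ.pi fun i => Set.univ.pi (box i)
  have hK : IsCompact K := by
    refine isCompact_univ_pi fun i => isCompact_univ_pi fun u => ?_
    simp only [box]
    split_ifs
    · exact isCompact_Icc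
    · exact isCompact_singleton
  have hload : Continuous load := by fun_prop
  have hG : Continuous (binGfun m N f q r c) := by unfold binGfun; fun_prop
  have hKY : ∀ y ∈ K ∩ {y | load y ≤ N / m}, y ∈ binYset m N f q := by
    rintro y ⟨hy, hl⟩
    refine ⟨fun i h1 hm u hu1 hu2 => ?_, hl⟩
    have h := hy i trivial u trivial
    simpa only [box, h1, hm, hu1, hu2, and_self, if_true, Set.mem_Icc] using h
  have htr : ∀ y, ∀ i ∈ Finset.Icc 1 m, trunc y i 1 = y i 1 ∧ trunc y i 2 = y i 2 := by
    intro y i hi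
    have := Finset.mem_Icc.1 hi
    simp [trunc, this]
  have hYK : ∀ y ∈ binYset m N f q, trunc y ∈ K ∩ {y | load y ≤ N / m} := by
    rintro y ⟨hy, hl⟩
    refine ⟨fun i _ u _ => ?_, ?_⟩
    · simp only [box, trunc]
      split_ifs with h
      · exact hy i h.1.1 h.1.2 u h.2.1 h.2.2
      · rfl
    · refine le_of_eq_of_le (Finset.sum_congr rfl fun i hi => ?_) hl
      rw [(htr y i hi).1, (htr y i hi).2]
  have hGtr : ∀ y, binGfun m N f q r c (trunc y) = binGfun m N f q r c y := by
    intro y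
    unfold binGfun
    congr 1
    refine Finset.sum_congr rfl fun i hi => ?_
    rw [(htr y i hi).1, (htr y i hi).2]
  have hzero : (0 : ℕ → ℕ → ℝ) ∈ binYset m N f q := by
    refine ⟨fun i _ hm u _ _ => ⟨le_rfl, ?_⟩, ?_⟩
    · have : (i : ℝ) ≤ m := by exact_mod_cast hm
      have : (0 : ℝ) ≤ (m : ℝ) - i + 1 := by linarith
      simpa using this
    · simpa using div_nonneg hN.le (Nat.cast_nonneg m)
  obtain ⟨y, hy, hmax⟩ := (hK.inter_right (isClosed_le hload continuous_const)).exists_isMaxOn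
    ⟨_, hYK 0 hzero⟩ hG.continuousOn
  exact ⟨y, hKY y hy, fun y' hy' => hGtr y' ▸ hmax (hYK y' hy')⟩

/-- At a maximizer, mass at `(j, v)` forces every coordinate `(i, u)` of strictly larger
value per unit of capacity to be saturated. -/
theorem eq_cap_of_density_lt {m : ℕ} {N f q r c : ℝ} (hN : 0 < N) (hf : 0 < f) (hq0 : 0 < q)
    (hq1 : q < 1) {y : ℕ → ℕ → ℝ} (hy : y ∈ binYset m N f q)
    (hmax : ∀ y' ∈ binYset m N f q, binGfun m N f q r c y' ≤ binGfun m N f q r c y)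
    {i j u v : ℕ} (hi : 1 ≤ i ∧ i ≤ m) (hj : 1 ≤ j ∧ j ≤ m) (hu : u = 1 ∨ u = 2)
    (hv : v = 1 ∨ v = 2)
    (hlt : ((m : ℝ) - j + 1) * (if v = 1 then c else c - r) <
      ((m : ℝ) - i + 1) * (if u = 1 then c else c - r))
    (hpos : y j v ≠ 0) : y i u = 1 / ((m : ℝ) - i + 1) := by
  have hiu := hy.1 i hi.1 hi.2 u (by omega) (by omega)
  have hjv := hy.1 j hj.1 hj.2 v (by omega) (by omega)
  by_contra hne
  have hw : ∀ t : ℕ, 0 < (if t = 1 then q else 1 - q) := by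
    intro t; split_ifs <;> linarith
  have hyj : 0 < y j v := lt_of_le_of_ne hjv.1 hpos.symm
  have hyi : y i u < 1 / ((m : ℝ) - i + 1) := lt_of_le_of_ne hiu.2 hne
  set wu := if u = 1 then q else 1 - q with hwu
  set wv := if v = 1 then q else 1 - q with hwv
  have hwu0 : 0 < wu := hw u
  have hwv0 : 0 < wv := hw v
  obtain ⟨ε, hε, hε1, hε2⟩ : ∃ ε > 0, ε / wv ≤ y j v ∧
      ε / wu ≤ 1 / ((m : ℝ) - i + 1) - y i u := by
    refine ⟨min (y j v * wv) ((1 / ((m : ℝ) - i + 1) - y i u) * wu),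
      lt_min (mul_pos hyj hwv0) (mul_pos (by linarith) hwu0), ?_, ?_⟩
    · exact (div_le_iff₀ hwv0).2 (min_le_left _ _)
    · exact (div_le_iff₀ hwu0).2 (min_le_right _ _)
  have hεu : 0 < ε / wu := div_pos hε hwu0
  have hεv : 0 < ε / wv := div_pos hε hwv0
  have hiI : i ∈ Finset.Icc 1 m := Finset.mem_Icc.2 hi
  have hjI : j ∈ Finset.Icc 1 m := Finset.mem_Icc.2 hj
  have hmem : y + Pi.single i (Pi.single u (ε / wu)) + Pi.single j (Pi.single v (-(ε / wv))) ∈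
      binYset m N f q := by
    refine ⟨fun k hk1 hk2 t ht1 ht2 => ?_, ?_⟩
    · have hkt := hy.1 k hk1 hk2 t ht1 ht2
      have hsingle : ∀ (a b : ℕ) (δ : ℝ), (Pi.single a (Pi.single b δ) : ℕ → ℕ → ℝ) k t =
          if k = a ∧ t = b then δ else 0 := by
        intro a b δ
        by_cases hka : k = a
        · subst hka; simp [Pi.single_apply]
        · simp [hka]
      simp only [Pi.add_apply, hsingle]
      by_cases h1 : k = i ∧ t = u
      · obtain ⟨rfl, rfl⟩ := h1
        have h2 : ¬ (k = j ∧ t = v) := by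
          rintro ⟨rfl, rfl⟩; exact lt_irrefl _ hlt
        rw [if_pos ⟨rfl, rfl⟩, if_neg h2]
        constructor <;> linarith
      · rw [if_neg h1]
        by_cases h2 : k = j ∧ t = v
        · obtain ⟨rfl, rfl⟩ := h2
          rw [if_pos ⟨rfl, rfl⟩]
          constructor <;> linarith
        · rw [if_neg h2]
          constructor <;> linarith
    · rw [sum_add_single_single (fun _ => f * N / m) _ _ _ _ hjI hv,
        sum_add_single_single (fun _ => f * N / m) _ _ _ _ hiI hu,
        ← hwu, ← hwv, mul_neg, mul_div_cancel₀ _ hwu0.ne', mul_div_cancel₀ _ hwv0.ne']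
      linarith [hy.2]
  have hle := hmax _ hmem
  unfold binGfun at hle
  rw [sum_add_single_single (fun k : ℕ => ((m : ℝ) - k + 1) * (f * N / m)) _ _ _ _ hjI hv,
    sum_add_single_single (fun k : ℕ => ((m : ℝ) - k + 1) * (f * N / m)) _ _ _ _ hiI hu] at hle
  have hval : ∀ t : ℕ, (if t = 1 then q * c else (1 - q) * (c - r)) =
      (if t = 1 then q else 1 - q) * (if t = 1 then c else c - r) := by
    intro t; split_ifs <;> rfl
  rw [hval, hval, ← hwu, ← hwv] at hle
  set gu := if u = 1 then c else c - r
  set gv := if v = 1 then c else c - r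
  have e1 : wu * gu * (ε / wu) = gu * ε := by field_simp
  have e2 : wv * gv * (-(ε / wv)) = -(gv * ε) := by field_simp
  rw [e1, e2] at hle
  have hm0 : (0 : ℝ) < m := by exact_mod_cast hi.1.trans hi.2
  have hK : 0 < f * N / m * ε := by positivity
  nlinarith [mul_lt_mul_of_pos_right hlt hK]

/-- The last index in `{1, …, m}` satisfying `P`, or `1` if there is none. -/
theorem exists_last_index {m : ℕ} (hm : 1 ≤ m) (P : ℕ → Prop) :
    ∃ z, 1 ≤ z ∧ z ≤ m ∧ (∀ i, z < i → i ≤ m → ¬ P i) ∧ (z = 1 ∨ P z) := by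
  induction m, hm using Nat.le_induction with
  | base => exact ⟨1, le_rfl, le_rfl, fun i h1 h2 => by omega, Or.inl rfl⟩
  | succ m hm ih =>
    by_cases hP : P (m + 1)
    · exact ⟨m + 1, by omega, le_rfl, fun i h1 h2 => by omega, Or.inr hP⟩
    · obtain ⟨z, h1, h2, h3, h4⟩ := ih
      refine ⟨z, h1, by omega, fun i hi him => ?_, h4⟩
      rcases Nat.lt_or_ge m i with h | h
      · rwa [show i = m + 1 by omega]
      · exact h3 i hi h

/-- Lemma 2.7: `G` attains its maximum on `Y`, and every maximizer admits integer
thresholds `1 ≤ z₂ ≤ z₁ ≤ m` such that for `u = 1, 2`, `y_{i,u} = 1/(m−i+1)`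
for `i < z_u` and `y_{i,u} = 0` for `i > z_u`. -/
theorem binary_adversary_lp_thresholds (m : ℕ) (hm : 1 ≤ m) (N f q r c : ℝ)
    (hN : 0 < N) (hf : 1 ≤ f) (hq0 : 0 < q) (hq1 : q < 1)
    (hr : 0 < r) (hrc : r < c) :
    (∃ y ∈ binYset m N f q, ∀ y' ∈ binYset m N f q,
      binGfun m N f q r c y' ≤ binGfun m N f q r c y) ∧
    ∀ y ∈ binYset m N f q,
      (∀ y' ∈ binYset m N f q, binGfun m N f q r c y' ≤ binGfun m N f q r c y) →
      ∃ z₁ z₂ : ℕ, 1 ≤ z₂ ∧ z₂ ≤ z₁ ∧ z₁ ≤ m ∧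
        (∀ i, 1 ≤ i → i < z₁ → y i 1 = 1 / ((m : ℝ) - i + 1)) ∧
        (∀ i, z₁ < i → i ≤ m → y i 1 = 0) ∧
        (∀ i, 1 ≤ i → i < z₂ → y i 2 = 1 / ((m : ℝ) - i + 1)) ∧
        (∀ i, z₂ < i → i ≤ m → y i 2 = 0) := by
  refine ⟨exists_isMaxOn_binYset m hN, fun y hy hmax => ?_⟩
  have hcap : ∀ i : ℕ, i ≤ m → 0 < (m : ℝ) - i + 1 := by
    intro i hi
    have : (i : ℝ) ≤ m := by exact_mod_cast hi
    linarith
  have hsame : ∀ u, (u = 1 ∨ u = 2) → ∀ i j, 1 ≤ i → i < j → j ≤ m → y j u ≠ 0 →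
      y i u = 1 / ((m : ℝ) - i + 1) := by
    intro u hu i j hi hij hj h
    refine eq_cap_of_density_lt hN (by linarith) hq0 hq1 hy hmax ⟨hi, by omega⟩
      ⟨by omega, hj⟩ hu hu ?_ h
    have : (i : ℝ) < j := by exact_mod_cast hij
    exact mul_lt_mul_of_pos_right (by linarith) (by split_ifs <;> linarith)
  have hcross : ∀ j, 1 ≤ j → j ≤ m → y j 2 ≠ 0 → y j 1 ≠ 0 := by
    intro j h1 h2 h
    rw [eq_cap_of_density_lt (i := j) (u := 1) hN (by linarith) hq0 hq1 hy hmax ⟨h1, h2⟩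
      ⟨h1, h2⟩ (Or.inl rfl) (Or.inr rfl) ?_ h]
    · exact (one_div_pos.2 (hcap j h2)).ne'
    · simpa using mul_lt_mul_of_pos_left (show c - r < c by linarith) (hcap j h2)
  obtain ⟨z₁, h11, h1m, h1z, h1p⟩ := exists_last_index hm fun i => y i 1 ≠ 0
  obtain ⟨z₂, h21, h2m, h2z, h2p⟩ := exists_last_index hm fun i => y i 2 ≠ 0
  refine ⟨z₁, z₂, h21, ?_, h1m, ?_, fun i h h' => not_not.1 (h1z i h h'), ?_,
    fun i h h' => not_not.1 (h2z i h h')⟩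
  · by_contra! hlt
    rcases h2p with h | h
    · omega
    · exact h1z z₂ hlt h2m (hcross z₂ h21 h2m h)
  · intro i hi hiz
    rcases h1p with h | h
    · omega
    · exact hsame 1 (Or.inl rfl) i z₁ hi hiz h1m h
  · intro i hi hiz
    rcases h2p with h | h
    · omega
    · exact hsame 2 (Or.inr rfl) i z₂ hi hiz h2m h
end

section
/- For u ∈ {1,…,d} set δ_u := 1 − 1/(q_{d+1−u}·t·f), and define β*_1 := N/t and, for each u ∈ {1,…,d} and each j with σ_{u−1} + 1 < j ≤ σ_u + 1 (and j ≤ t), β*_j := (N/t)·(Π_{v=1}^{u−1} δ_v^{σ_v − σ_{v−1}})·δ_u^{j − σ_{u−1} − 1}. Then β* is feasible for the general LP and for every feasible vector β one has Ψ(β*) ≤ Ψ(β); that is, β* is an optimal (minimizing) solution of the general LP. (Claim 3.2) -/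
/-- `E_u`: the conditional mean of the AdEx reward given that it is at most
`r_{d+1−u}`, namely `(Σ_{j=1}^{d+1−u} (q_j − q_{j−1})·r_j)/q_{d+1−u}`. -/
noncomputable def condMean (d : ℕ) (q r : ℕ → ℝ) (u : ℕ) : ℝ :=
  (∑ j ∈ Finset.Icc 1 (d + 1 - u), (q j - q (j - 1)) * r j) / q (d + 1 - u)

/-- Feasibility for the general LP with thresholds `σ_0 ≤ σ_1 ≤ ⋯ ≤ σ_d`. -/
def genFeasible (t d : ℕ) (σ : ℕ → ℕ) (N f : ℝ) (q : ℕ → ℝ) (β : ℕ → ℝ) : Prop :=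
  (∀ j, 1 ≤ j → j ≤ t → 0 ≤ β j) ∧
  β 1 = N / t ∧
  (∀ u, 1 ≤ u → u ≤ d → ∀ j, σ (u - 1) < j → j ≤ σ u → j ≤ t - 1 →
    f * t * (β 1 - β (j + 1)) ≤
      (∑ v ∈ Finset.Icc 1 (u - 1),
        (1 / q (d + 1 - v)) * ∑ ℓ ∈ Finset.Icc (σ (v - 1) + 1) (σ v), β ℓ)
      + (1 / q (d + 1 - u)) * ∑ ℓ ∈ Finset.Icc (σ (u - 1) + 1) j, β ℓ)

/-- The objective `Ψ` of the general LP. -/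
noncomputable def genObj (d : ℕ) (σ : ℕ → ℕ) (N f c : ℝ) (q r : ℕ → ℝ)
    (β : ℕ → ℝ) : ℝ :=
  -c * N + (∑ u ∈ Finset.Icc 1 d, f * N * (q u - q (u - 1)) * r u)
    + ∑ u ∈ Finset.Icc 1 d,
        (c - condMean d q r u) * ∑ j ∈ Finset.Icc (σ (u - 1) + 1) (σ u), β j

/-- Monotonicity on `{m, …, d}` from monotonicity of consecutive values. -/
theorem le_of_forall_le_succ_of_lt {α : Type*} [Preorder α] {s : ℕ → α} {m d : ℕ}
    (h : ∀ u, m ≤ u → u < d → s u ≤ s (u + 1)) {i j : ℕ} (hi : m ≤ i) (hij : i ≤ j)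
    (hj : j ≤ d) : s i ≤ s j := by
  induction j, hij using Nat.le_induction with
  | base => exact le_rfl
  | succ k hk ih => exact (ih (by omega)).trans (h k (by omega) (by omega))

/-- The index of the block of the thresholds `σ` which contains `l`. -/
noncomputable def blockIndex (σ : ℕ → ℕ) (l : ℕ) : ℕ := sInf {u | l ≤ σ u}

theorem blockIndex_spec {σ : ℕ → ℕ} {d l : ℕ} (hσ0 : σ 0 = 0) (hl : 1 ≤ l) (hld : l ≤ σ d) :
    1 ≤ blockIndex σ l ∧ blockIndex σ l ≤ d ∧ σ (blockIndex σ l - 1) < l ∧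
      l ≤ σ (blockIndex σ l) := by
  have hmem : l ≤ σ (blockIndex σ l) := Nat.sInf_mem (s := {u | l ≤ σ u}) ⟨d, hld⟩
  have hpos : 1 ≤ blockIndex σ l := by
    by_contra h
    have h0 : blockIndex σ l = 0 := by omega
    rw [h0, hσ0] at hmem
    omega
  refine ⟨hpos, Nat.sInf_le hld, ?_, hmem⟩
  have h : blockIndex σ l - 1 < sInf {u | l ≤ σ u} := by
    change blockIndex σ l - 1 < blockIndex σ l
    omega
  simpa using Nat.notMem_of_lt_sInf h

theorem blockIndex_eq {σ : ℕ → ℕ} {d u l : ℕ} (hσ0 : σ 0 = 0)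
    (hσ : ∀ u, u < d → σ u ≤ σ (u + 1)) (hud : u ≤ d)
    (h1 : σ (u - 1) < l) (h2 : l ≤ σ u) : blockIndex σ l = u := by
  have hmono : ∀ {i j : ℕ}, i ≤ j → j ≤ d → σ i ≤ σ j := fun hij hj =>
    le_of_forall_le_succ_of_lt (m := 0) (fun u _ => hσ u) (Nat.zero_le _) hij hj
  obtain ⟨hb1, hb2, hb3, hb4⟩ :=
    blockIndex_spec (d := d) hσ0 (by omega) (h2.trans (hmono hud le_rfl))
  rcases lt_trichotomy (blockIndex σ l) u with h | h | h
  · have := hmono (show blockIndex σ l ≤ u - 1 by omega) (by omega)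
    omega
  · exact h
  · have := hmono (show u ≤ blockIndex σ l - 1 by omega) (by omega)
    omega

theorem blockIndex_mono {σ : ℕ → ℕ} {l m d : ℕ} (hlm : l ≤ m) (hm : m ≤ σ d) :
    blockIndex σ l ≤ blockIndex σ m :=
  Nat.sInf_le (hlm.trans (Nat.sInf_mem (s := {u | m ≤ σ u}) ⟨d, hm⟩))

/-- A product over `{1, …, σ m}` splits into the products over the blocks. -/
@[to_additive]
theorem prod_Icc_blocks {M : Type*} [CommMonoid M] {σ : ℕ → ℕ} {d m : ℕ} (hσ0 : σ 0 = 0)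
    (hσ : ∀ u, u < d → σ u ≤ σ (u + 1)) (hm : m ≤ d) (g : ℕ → M) :
    ∏ l ∈ Finset.Icc 1 (σ m), g l =
      ∏ v ∈ Finset.Icc 1 m, ∏ l ∈ Finset.Icc (σ (v - 1) + 1) (σ v), g l := by
  induction m with
  | zero => simp [hσ0]
  | succ k ih =>
    rw [Finset.prod_Icc_succ_top (by omega), ← ih (by omega), Nat.add_sub_cancel]
    have h := Finset.prod_Ioc_consecutive g (Nat.zero_le (σ k)) (hσ k (by omega))
    simp only [← Finset.Icc_add_one_left_eq_Ioc, zero_add] at h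
    exact h.symm

/-- A product over `{1, …, j}` splits into the products over the blocks before that of `j`
and the part of the block of `j` up to `j`. -/
@[to_additive]
theorem prod_Icc_partial_block {M : Type*} [CommMonoid M] {σ : ℕ → ℕ} {d u j : ℕ}
    (hσ0 : σ 0 = 0) (hσ : ∀ u, u < d → σ u ≤ σ (u + 1)) (hud : u ≤ d)
    (h1 : σ (u - 1) < j) (g : ℕ → M) :
    ∏ l ∈ Finset.Icc 1 j, g l =
      (∏ v ∈ Finset.Icc 1 (u - 1), ∏ l ∈ Finset.Icc (σ (v - 1) + 1) (σ v), g l) *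
        ∏ l ∈ Finset.Icc (σ (u - 1) + 1) j, g l := by
  rw [← prod_Icc_blocks hσ0 hσ (by omega)]
  have h := Finset.prod_Ioc_consecutive g (Nat.zero_le (σ (u - 1))) h1.le
  simp only [← Finset.Icc_add_one_left_eq_Ioc, zero_add] at h
  exact h.symm

theorem sum_Icc_block_mul {σ : ℕ → ℕ} {d v n : ℕ} (hσ0 : σ 0 = 0)
    (hσ : ∀ u, u < d → σ u ≤ σ (u + 1)) (hvd : v ≤ d) (hn : n ≤ σ v) (F β : ℕ → ℝ) :
    ∑ l ∈ Finset.Icc (σ (v - 1) + 1) n, F (blockIndex σ l) * β l =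
      F v * ∑ l ∈ Finset.Icc (σ (v - 1) + 1) n, β l := by
  rw [Finset.mul_sum]
  refine Finset.sum_congr rfl fun l hl => ?_
  rw [Finset.mem_Icc] at hl
  rw [blockIndex_eq hσ0 hσ hvd (by omega) (by omega)]

theorem prod_Icc_block_const {σ : ℕ → ℕ} {d v n : ℕ} (hσ0 : σ 0 = 0)
    (hσ : ∀ u, u < d → σ u ≤ σ (u + 1)) (hvd : v ≤ d) (hn : n ≤ σ v) (F : ℕ → ℝ) :
    ∏ l ∈ Finset.Icc (σ (v - 1) + 1) n, F (blockIndex σ l) = F v ^ (n - σ (v - 1)) := by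
  rw [Finset.prod_congr rfl (g := fun _ => F v)]
  · simp
  · intro l hl
    rw [Finset.mem_Icc] at hl
    rw [blockIndex_eq hσ0 hσ hvd (by omega) (by omega)]

/-- Abel summation: nonnegative partial sums stay nonnegative under nonnegative
antitone weights. -/
theorem mul_sum_le_sum_mul_of_antitone {t : ℕ} {K x : ℕ → ℝ}
    (hK : ∀ l, 1 ≤ l → l < t → K (l + 1) ≤ K l)
    (hx : ∀ n, 1 ≤ n → n ≤ t → 0 ≤ ∑ l ∈ Finset.Icc 1 n, x l)
    {n : ℕ} (hn : 1 ≤ n) (hnt : n ≤ t) :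
    K n * ∑ l ∈ Finset.Icc 1 n, x l ≤ ∑ l ∈ Finset.Icc 1 n, K l * x l := by
  induction n, hn using Nat.le_induction with
  | base => simp
  | succ k hk ih =>
    rw [Finset.sum_Icc_succ_top (by omega), Finset.sum_Icc_succ_top (by omega), mul_add]
    have := mul_le_mul_of_nonneg_right (hK k hk (by omega)) (hx k hk (by omega))
    linarith [ih (by omega)]

/-- A solution of the recursion `y (j + 1) = y j * (1 - a j)` is the tight solution of the
covering constraints `y 1 - y (j + 1) ≤ ∑ l ≤ j, a l * y l`. -/
theorem sub_eq_sum_of_recursion {t : ℕ} {a y : ℕ → ℝ}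
    (hy : ∀ j, 1 ≤ j → j < t → y (j + 1) = y j * (1 - a j)) {j : ℕ} (hjt : j < t) :
    y 1 - y (j + 1) = ∑ l ∈ Finset.Icc 1 j, a l * y l := by
  induction j with
  | zero => simp
  | succ k ih =>
    rw [Finset.sum_Icc_succ_top (by omega), ← ih (by omega), hy (k + 1) (by omega) hjt]
    ring

/-- The tight solution has the least weighted partial sums among all vectors satisfying the
covering constraints. -/
theorem sum_le_sum_of_covering {t : ℕ} {a x y : ℕ → ℝ}
    (ha0 : ∀ l, 1 ≤ l → l ≤ t → 0 ≤ a l) (ha1 : ∀ l, 1 ≤ l → l ≤ t → a l ≤ 1)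
    (hxy : x 1 = y 1)
    (hy : ∀ j, 1 ≤ j → j < t → y (j + 1) = y j * (1 - a j))
    (hx : ∀ j, 1 ≤ j → j < t → x 1 - x (j + 1) ≤ ∑ l ∈ Finset.Icc 1 j, a l * x l)
    {n : ℕ} (hn : 1 ≤ n) (hnt : n ≤ t) :
    ∑ l ∈ Finset.Icc 1 n, a l * y l ≤ ∑ l ∈ Finset.Icc 1 n, a l * x l := by
  induction n, hn using Nat.le_induction with
  | base => simp [hxy]
  | succ k hk ih =>
    have ih' := ih (by omega)
    have hyk := sub_eq_sum_of_recursion hy (show k < t by omega)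
    have hxk := hx k hk (by omega)
    have h0 := ha0 (k + 1) (by omega) hnt
    have h1 := ha1 (k + 1) (by omega) hnt
    rw [Finset.sum_Icc_succ_top (by omega), Finset.sum_Icc_succ_top (by omega)]
    have e1 := mul_le_mul_of_nonneg_left hxk h0
    have e2 := mul_le_mul_of_nonneg_left ih' (sub_nonneg.2 h1)
    rw [← hyk] at e2 ⊢
    rw [hxy] at e1
    linarith

theorem sum_mul_le_sum_mul_of_covering {t : ℕ} (ht : 1 ≤ t) {a K x y : ℕ → ℝ}
    (ha0 : ∀ l, 1 ≤ l → l ≤ t → 0 ≤ a l) (ha1 : ∀ l, 1 ≤ l → l ≤ t → a l ≤ 1)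
    (hK : ∀ l, 1 ≤ l → l < t → K (l + 1) ≤ K l) (hKt : 0 ≤ K t)
    (hxy : x 1 = y 1)
    (hy : ∀ j, 1 ≤ j → j < t → y (j + 1) = y j * (1 - a j))
    (hx : ∀ j, 1 ≤ j → j < t → x 1 - x (j + 1) ≤ ∑ l ∈ Finset.Icc 1 j, a l * x l) :
    ∑ l ∈ Finset.Icc 1 t, K l * (a l * y l) ≤ ∑ l ∈ Finset.Icc 1 t, K l * (a l * x l) := by
  have hpart : ∀ n, 1 ≤ n → n ≤ t → 0 ≤ ∑ l ∈ Finset.Icc 1 n, (a l * x l - a l * y l) := by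
    intro n hn hnt
    rw [Finset.sum_sub_distrib]
    exact sub_nonneg.2 (sum_le_sum_of_covering ha0 ha1 hxy hy hx hn hnt)
  have h := mul_sum_le_sum_mul_of_antitone hK hpart ht le_rfl
  have h0 := mul_nonneg hKt (hpart t ht le_rfl)
  simp only [mul_sub, Finset.sum_sub_distrib] at h h0
  linarith

/-- The weighted gap `∑_{j ≤ k} (q_j - q_{j-1}) (c - r_j)` between `c` and the rewards. -/
noncomputable def rewardGap (c : ℝ) (q r : ℕ → ℝ) (k : ℕ) : ℝ :=
  ∑ j ∈ Finset.Icc 1 k, (q j - q (j - 1)) * (c - r j)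

theorem rewardGap_eq (c : ℝ) {q : ℕ → ℝ} (r : ℕ → ℝ) (hq0 : q 0 = 0) (k : ℕ) :
    rewardGap c q r k = c * q k - ∑ j ∈ Finset.Icc 1 k, (q j - q (j - 1)) * r j := by
  unfold rewardGap
  induction k with
  | zero => simp [hq0]
  | succ k ih =>
    rw [Finset.sum_Icc_succ_top (by omega), Finset.sum_Icc_succ_top (by omega), ih,
      Nat.add_sub_cancel]
    ring

theorem sub_condMean_eq (c : ℝ) {q : ℕ → ℝ} (r : ℕ → ℝ) (d u : ℕ) (hq0 : q 0 = 0)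
    (hq : q (d + 1 - u) ≠ 0) :
    c - condMean d q r u = rewardGap c q r (d + 1 - u) / q (d + 1 - u) := by
  rw [rewardGap_eq c r hq0, condMean]
  field_simp

theorem rewardGap_mono {c : ℝ} {q r : ℕ → ℝ} {d k m : ℕ}
    (hq : ∀ j, 1 ≤ j → j ≤ d → q (j - 1) ≤ q j) (hr : ∀ j, 1 ≤ j → j ≤ d → r j ≤ c)
    (hkm : k ≤ m) (hmd : m ≤ d) : rewardGap c q r k ≤ rewardGap c q r m := by
  refine Finset.sum_le_sum_of_subset_of_nonneg (Finset.Icc_subset_Icc_right hkm) ?_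
  intro j hj _
  rw [Finset.mem_Icc] at hj
  exact mul_nonneg (sub_nonneg.2 (hq j hj.1 (hj.2.trans hmd)))
    (sub_nonneg.2 (hr j hj.1 (hj.2.trans hmd)))

/-- Claim 3.2: the vector `β*` (defined piecewise via `δ_u = 1 − 1/(q_{d+1−u}·t·f)`)
is feasible for the general LP and minimizes the objective `Ψ` over all feasible
vectors. -/
theorem general_lp_optimal (t d : ℕ) (ht : 1 ≤ t) (hd : 1 ≤ d)
    (σ : ℕ → ℕ) (hσ0 : σ 0 = 0) (hσd : σ d = t)
    (hσmono : ∀ u, u < d → σ u ≤ σ (u + 1))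
    (N f c : ℝ) (hN : 0 < N) (hf : 1 ≤ f) (hc : 0 < c)
    (q : ℕ → ℝ) (hq0 : q 0 = 0) (hq1 : 0 < q 1) (hqd : q d = 1)
    (hqmono : ∀ u, 1 ≤ u → u < d → q u ≤ q (u + 1))
    (hq1tf : 1 ≤ q 1 * t * f)
    (r : ℕ → ℝ) (hr1 : r 1 = 0)
    (hrmono : ∀ u, 1 ≤ u → u < d → r u ≤ r (u + 1)) (hrd : r d ≤ c)
    (δ : ℕ → ℝ) (hδ : ∀ u, δ u = 1 - 1 / (q (d + 1 - u) * t * f))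
    (βstar : ℕ → ℝ) (hβ1 : βstar 1 = N / t)
    (hβ : ∀ u, 1 ≤ u → u ≤ d → ∀ j, σ (u - 1) + 1 < j → j ≤ σ u + 1 → j ≤ t →
      βstar j = (N / t) * (∏ v ∈ Finset.Icc 1 (u - 1), δ v ^ (σ v - σ (v - 1)))
        * δ u ^ (j - σ (u - 1) - 1)) :
    genFeasible t d σ N f q βstar ∧
    ∀ β : ℕ → ℝ, genFeasible t d σ N f q β →
      genObj d σ N f c q r βstar ≤ genObj d σ N f c q r β := by
  have htpos : (0 : ℝ) < t := by exact_mod_cast ht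
  have hfpos : 0 < f := by linarith
  have hqle : ∀ {i j : ℕ}, 1 ≤ i → i ≤ j → j ≤ d → q i ≤ q j := fun hi hij hj =>
    le_of_forall_le_succ_of_lt hqmono hi hij hj
  have hqpos : ∀ k, 1 ≤ k → k ≤ d → 0 < q k := fun k hk hkd =>
    hq1.trans_le (hqle le_rfl hk hkd)
  have hqstep : ∀ j, 1 ≤ j → j ≤ d → q (j - 1) ≤ q j := by
    intro j hj hjd
    rcases hj.eq_or_lt with h | h
    · rw [← h, Nat.sub_self, hq0]
      exact hq1.le
    · exact hqle (by omega) (by omega) hjd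
  have hrc : ∀ j, 1 ≤ j → j ≤ d → r j ≤ c := fun j hj hjd =>
    (le_of_forall_le_succ_of_lt hrmono hj hjd le_rfl).trans hrd
  have hb : ∀ l, 1 ≤ l → l ≤ t → 1 ≤ blockIndex σ l ∧ blockIndex σ l ≤ d ∧
      σ (blockIndex σ l - 1) < l ∧ l ≤ σ (blockIndex σ l) := fun l hl hlt =>
    blockIndex_spec hσ0 hl (hσd ▸ hlt)
  set a : ℕ → ℝ := fun l => 1 / (q (d + 1 - blockIndex σ l) * t * f) with ha
  have ha0 : ∀ l, 1 ≤ l → l ≤ t → 0 ≤ a l := by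
    intro l hl hlt
    obtain ⟨h1, h2, -, -⟩ := hb l hl hlt
    have := hqpos (d + 1 - blockIndex σ l) (by omega) (by omega)
    simp only [ha]
    positivity
  have ha1 : ∀ l, 1 ≤ l → l ≤ t → a l ≤ 1 := by
    intro l hl hlt
    obtain ⟨h1, h2, -, -⟩ := hb l hl hlt
    have hq := hqle (i := 1) (j := d + 1 - blockIndex σ l) le_rfl (by omega) (by omega)
    have : 1 ≤ q (d + 1 - blockIndex σ l) * t * f := hq1tf.trans (by gcongr)
    simp only [ha]
    exact (div_le_one (by linarith)).2 this
  have hclosed : ∀ j, 1 ≤ j → j ≤ t →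
      βstar j = N / t * ∏ l ∈ Finset.Icc 1 (j - 1), (1 - a l) := by
    intro j hj hjt
    rcases hj.eq_or_lt with h | h
    · simp [← h, hβ1]
    · obtain ⟨h1, h2, h3, h4⟩ := hb (j - 1) (by omega) (by omega)
      set u := blockIndex σ (j - 1)
      have hprod : ∏ l ∈ Finset.Icc 1 (j - 1), (1 - a l) =
          ∏ l ∈ Finset.Icc 1 (j - 1), δ (blockIndex σ l) :=
        Finset.prod_congr rfl fun l _ => (hδ _).symm
      rw [hβ u h1 h2 j (by omega) (by omega) hjt, hprod,
        prod_Icc_partial_block hσ0 hσmono h2 h3, prod_Icc_block_const hσ0 hσmono h2 h4,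
        show j - σ (u - 1) - 1 = j - 1 - σ (u - 1) by omega, mul_assoc]
      congr 2
      refine Finset.prod_congr rfl fun v hv => ?_
      rw [Finset.mem_Icc] at hv
      rw [prod_Icc_block_const hσ0 hσmono (by omega) le_rfl]
  have hrec : ∀ j, 1 ≤ j → j < t → βstar (j + 1) = βstar j * (1 - a j) := by
    intro j hj hjt
    rw [hclosed (j + 1) (by omega) hjt, hclosed j hj hjt.le]
    obtain ⟨k, rfl⟩ := Nat.exists_eq_add_of_le' hj
    rw [Nat.add_sub_cancel, Nat.add_sub_cancel, Finset.prod_Icc_succ_top (by omega)]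
    ring
  have hcon : ∀ (β : ℕ → ℝ) (u j : ℕ), 1 ≤ u → u ≤ d → σ (u - 1) < j → j ≤ σ u →
      (∑ v ∈ Finset.Icc 1 (u - 1),
        (1 / q (d + 1 - v)) * ∑ ℓ ∈ Finset.Icc (σ (v - 1) + 1) (σ v), β ℓ)
      + (1 / q (d + 1 - u)) * ∑ ℓ ∈ Finset.Icc (σ (u - 1) + 1) j, β ℓ
      = f * t * ∑ l ∈ Finset.Icc 1 j, a l * β l := by
    intro β u j _ hud h1 h2
    have hsum : f * t * ∑ l ∈ Finset.Icc 1 j, a l * β l =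
        ∑ l ∈ Finset.Icc 1 j, 1 / q (d + 1 - blockIndex σ l) * β l := by
      rw [Finset.mul_sum]
      refine Finset.sum_congr rfl fun l _ => ?_
      simp only [ha]
      field_simp
    rw [hsum, sum_Icc_partial_block hσ0 hσmono hud h1,
      sum_Icc_block_mul hσ0 hσmono hud h2 (fun v => 1 / q (d + 1 - v)) β]
    congr 1
    refine Finset.sum_congr rfl fun v hv => ?_
    rw [Finset.mem_Icc] at hv
    rw [sum_Icc_block_mul hσ0 hσmono (by omega) le_rfl (fun v => 1 / q (d + 1 - v)) β]
  refine ⟨⟨?_, hβ1, ?_⟩, ?_⟩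
  · intro j hj hjt
    rw [hclosed j hj hjt]
    refine mul_nonneg (by positivity) (Finset.prod_nonneg fun l hl => ?_)
    rw [Finset.mem_Icc] at hl
    exact sub_nonneg.2 (ha1 l hl.1 (by omega))
  · intro u hu hud j h1 h2 hjt
    rw [hcon βstar u j hu hud h1 h2, sub_eq_sum_of_recursion hrec (by omega)]
  · rintro β ⟨-, hβN, hβcon⟩
    set K : ℕ → ℝ := fun l => t * f * rewardGap c q r (d + 1 - blockIndex σ l) with hKdef
    have hobj : ∀ x : ℕ → ℝ, ∑ u ∈ Finset.Icc 1 d,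
        (c - condMean d q r u) * ∑ j ∈ Finset.Icc (σ (u - 1) + 1) (σ u), x j =
        ∑ l ∈ Finset.Icc 1 t, K l * (a l * x l) := by
      intro x
      have hsum : ∑ l ∈ Finset.Icc 1 t, K l * (a l * x l) =
          ∑ l ∈ Finset.Icc 1 (σ d), (c - condMean d q r (blockIndex σ l)) * x l := by
        rw [hσd]
        refine Finset.sum_congr rfl fun l hl => ?_
        rw [Finset.mem_Icc] at hl
        obtain ⟨h1, h2, -, -⟩ := hb l hl.1 hl.2
        have hq := hqpos (d + 1 - blockIndex σ l) (by omega) (by omega)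
        rw [sub_condMean_eq c r d _ hq0 hq.ne']
        simp only [ha, hKdef]
        field_simp
      rw [hsum, sum_Icc_blocks hσ0 hσmono le_rfl]
      refine Finset.sum_congr rfl fun v hv => ?_
      rw [Finset.mem_Icc] at hv
      rw [sum_Icc_block_mul hσ0 hσmono hv.2 le_rfl (fun v => c - condMean d q r v) x]
    have hkey := sum_mul_le_sum_mul_of_covering ht (K := K) (x := β) ha0 ha1 ?_ ?_
      (hβN.trans hβ1.symm) hrec ?_
    · unfold genObj
      rw [hobj, hobj]
      linarith
    · intro l hl hlt
      have hbl := (hb l hl hlt.le).1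
      have hmono := blockIndex_mono (σ := σ) (d := d) (show l ≤ l + 1 by omega) (by omega)
      refine mul_le_mul_of_nonneg_left ?_ (by positivity)
      exact rewardGap_mono hqstep hrc (by omega) (by omega)
    · have hbt := (hb t ht le_rfl).1
      have h := rewardGap_mono hqstep hrc (Nat.zero_le (d + 1 - blockIndex σ t)) (by omega)
      exact mul_nonneg (by positivity) (by simpa [rewardGap] using h)
    · intro j hj hjt
      obtain ⟨h1, h2, h3, h4⟩ := hb j hj hjt.le
      have h := hβcon _ h1 h2 j h3 h4 (by omega)
      rw [hcon β _ j h1 h2 h3 h4] at h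
      exact le_of_mul_le_mul_left h (by positivity)
end

section
/- The linear function G attains its maximum on the (compact) feasible set Y, and every maximizer y of G over Y admits integer thresholds z_1, z_2, …, z_d ∈ {1,…,m} with z_1 ≥ z_2 ≥ ⋯ ≥ z_d such that for every u ∈ {1,…,d}: y_{i,u} = 1/(m−i+1) for all i < z_u and y_{i,u} = 0 for all i > z_u. (Lemma 3.4) -/
/-- The feasible set `Y` of the adversary LP for a general AdEx distribution with
support size `d`: `0 ≤ y_{i,u} ≤ 1/(m−i+1)` for `i ∈ {1,…,m}`, `u ∈ {1,…,d}`,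
together with the capacity constraint on advertiser `π⁻¹(m)`. -/
def genYset (m d : ℕ) (N f : ℝ) (q : ℕ → ℝ) : Set (ℕ → ℕ → ℝ) :=
  {y | (∀ i, 1 ≤ i → i ≤ m → ∀ u, 1 ≤ u → u ≤ d →
          0 ≤ y i u ∧ y i u ≤ 1 / ((m : ℝ) - i + 1)) ∧
       ∑ i ∈ Finset.Icc 1 m,
         (f * N / m) * ∑ u ∈ Finset.Icc 1 d, (q u - q (u - 1)) * y i u ≤ N / m}

/-- The objective `G` of the adversary LP for a general AdEx distribution. -/
noncomputable def genGfun (m d : ℕ) (N f c : ℝ) (q r : ℕ → ℝ)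
    (y : ℕ → ℕ → ℝ) : ℝ :=
  -c * N + (∑ u ∈ Finset.Icc 1 d, f * N * (q u - q (u - 1)) * r u)
    + ∑ i ∈ Finset.Icc 1 m, ((m : ℝ) - i + 1) *
        ∑ u ∈ Finset.Icc 1 d, (f * N / m) * (q u - q (u - 1)) * (c - r u) * y i u

theorem sum_sum_mul_add_ite_sub_ite {m d i j u v : ℕ} (A y : ℕ → ℕ → ℝ) (s t : ℝ)
    (hi : i ∈ Finset.Icc 1 m) (hj : j ∈ Finset.Icc 1 m)
    (hu : u ∈ Finset.Icc 1 d) (hv : v ∈ Finset.Icc 1 d) :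
    ∑ k ∈ Finset.Icc 1 m, ∑ l ∈ Finset.Icc 1 d,
      A k l * (y k l + (if k = j then if l = v then s else 0 else 0)
        - (if k = i then if l = u then t else 0 else 0)) =
    (∑ k ∈ Finset.Icc 1 m, ∑ l ∈ Finset.Icc 1 d, A k l * y k l) + A j v * s - A i u * t := by
  have key : ∀ (a b : ℕ) (e : ℝ), a ∈ Finset.Icc 1 m → b ∈ Finset.Icc 1 d →
      ∑ k ∈ Finset.Icc 1 m, ∑ l ∈ Finset.Icc 1 d,
        A k l * (if k = a then if l = b then e else 0 else 0) = A a b * e := by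
    intro a b e ha hb
    rw [Finset.sum_eq_single_of_mem a ha fun k _ hk => by simp [hk],
      Finset.sum_eq_single_of_mem b hb fun l _ hl => by simp [hl]]
    simp
  simp only [mul_sub, mul_add, Finset.sum_sub_distrib, Finset.sum_add_distrib]
  rw [key j v s hj hv, key i u t hi hu]

/-- The capacity constraint with its left-hand side as a plain double sum. -/
theorem mem_genYset_iff {m d : ℕ} {N f : ℝ} {q : ℕ → ℝ} {y : ℕ → ℕ → ℝ} :
    y ∈ genYset m d N f q ↔
      (∀ i, 1 ≤ i → i ≤ m → ∀ u, 1 ≤ u → u ≤ d →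
        0 ≤ y i u ∧ y i u ≤ 1 / ((m : ℝ) - i + 1)) ∧
      ∑ i ∈ Finset.Icc 1 m, ∑ u ∈ Finset.Icc 1 d,
        (f * N / m) * (q u - q (u - 1)) * y i u ≤ N / m := by
  simp only [genYset, Set.mem_ofPred_eq, Finset.mul_sum, mul_assoc]

theorem genGfun_eq (m d : ℕ) (N f c : ℝ) (q r : ℕ → ℝ) (y : ℕ → ℕ → ℝ) :
    genGfun m d N f c q r y =
      -c * N + (∑ u ∈ Finset.Icc 1 d, f * N * (q u - q (u - 1)) * r u)
        + ∑ i ∈ Finset.Icc 1 m, ∑ u ∈ Finset.Icc 1 d,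
          ((m : ℝ) - i + 1) * ((f * N / m) * (q u - q (u - 1)) * (c - r u)) * y i u := by
  simp only [genGfun, Finset.mul_sum, mul_assoc]

theorem genGfun_congr {m d : ℕ} {N f c : ℝ} {q r : ℕ → ℝ} {y y' : ℕ → ℕ → ℝ}
    (h : ∀ i ∈ Finset.Icc 1 m, ∀ u ∈ Finset.Icc 1 d, y i u = y' i u) :
    genGfun m d N f c q r y = genGfun m d N f c q r y' := by
  simp only [genGfun_eq]
  congr 1
  exact Finset.sum_congr rfl fun i hi => Finset.sum_congr rfl fun u hu => by rw [h i hi u hu]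

theorem genYset_congr {m d : ℕ} {N f : ℝ} {q : ℕ → ℝ} {y y' : ℕ → ℕ → ℝ}
    (h : ∀ i ∈ Finset.Icc 1 m, ∀ u ∈ Finset.Icc 1 d, y i u = y' i u)
    (hy : y ∈ genYset m d N f q) : y' ∈ genYset m d N f q := by
  rw [mem_genYset_iff] at hy ⊢
  refine ⟨fun i hi him u hu hud => ?_, le_of_eq_of_le ?_ hy.2⟩
  · rw [← h i (Finset.mem_Icc.2 ⟨hi, him⟩) u (Finset.mem_Icc.2 ⟨hu, hud⟩)]
    exact hy.1 i hi him u hu hud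
  · exact Finset.sum_congr rfl fun i hi => Finset.sum_congr rfl fun u hu => by rw [h i hi u hu]

theorem continuous_genGfun (m d : ℕ) (N f c : ℝ) (q r : ℕ → ℝ) :
    Continuous (genGfun m d N f c q r) := by
  unfold genGfun
  fun_prop

/-- `genYset` only constrains finitely many coordinates; its members vanishing at all
other coordinates form a compact set. -/
theorem isCompact_genYset_inter (m d : ℕ) (N f : ℝ) (q : ℕ → ℝ) :
    IsCompact (genYset m d N f q ∩
      {y | ∀ i u, ¬ (i ∈ Finset.Icc 1 m ∧ u ∈ Finset.Icc 1 d) → y i u = 0}) := by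
  let B : ℕ → ℕ → Set ℝ := fun i u =>
    if i ∈ Finset.Icc 1 m ∧ u ∈ Finset.Icc 1 d then Set.Icc 0 (1 / ((m : ℝ) - i + 1)) else {0}
  have hB : IsCompact (Set.univ.pi fun i => Set.univ.pi (B i)) := by
    refine isCompact_univ_pi fun i => isCompact_univ_pi fun u => ?_
    by_cases h : i ∈ Finset.Icc 1 m ∧ u ∈ Finset.Icc 1 d
    · simpa only [B, if_pos h] using isCompact_Icc
    · simpa only [B, if_neg h] using isCompact_singleton
  have hC : IsClosed {y : ℕ → ℕ → ℝ | ∑ i ∈ Finset.Icc 1 m,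
      (f * N / m) * ∑ u ∈ Finset.Icc 1 d, (q u - q (u - 1)) * y i u ≤ N / m} :=
    isClosed_le (by fun_prop) continuous_const
  convert hB.inter_right hC using 1
  ext y
  simp only [genYset, Set.mem_inter_iff, Set.mem_ofPred_eq, Set.mem_univ_pi]
  constructor
  · rintro ⟨⟨hb, hs⟩, h0⟩
    refine ⟨fun i u => ?_, hs⟩
    by_cases h : i ∈ Finset.Icc 1 m ∧ u ∈ Finset.Icc 1 d
    · have h' := h
      simp only [Finset.mem_Icc] at h'
      simp only [B, if_pos h]
      exact hb i h'.1.1 h'.1.2 u h'.2.1 h'.2.2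
    · simp only [B, if_neg h]
      exact h0 i u h
  · rintro ⟨hb, hs⟩
    refine ⟨⟨fun i hi him u hu hud => ?_, hs⟩, fun i u h => ?_⟩
    · have h : i ∈ Finset.Icc 1 m ∧ u ∈ Finset.Icc 1 d :=
        ⟨Finset.mem_Icc.2 ⟨hi, him⟩, Finset.mem_Icc.2 ⟨hu, hud⟩⟩
      have := hb i u
      simp only [B, if_pos h] at this
      exact this
    · have := hb i u
      simp only [B, if_neg h] at this
      exact this

theorem exists_isMaxOn_genGfun (m d : ℕ) {N : ℝ} (hN : 0 ≤ N) (f c : ℝ) (q r : ℕ → ℝ) :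
    ∃ y ∈ genYset m d N f q, ∀ y' ∈ genYset m d N f q,
      genGfun m d N f c q r y' ≤ genGfun m d N f c q r y := by
  have hzero : (0 : ℕ → ℕ → ℝ) ∈ genYset m d N f q := by
    rw [mem_genYset_iff]
    refine ⟨fun i _ him u _ _ => ⟨le_rfl, ?_⟩, ?_⟩
    · have : (i : ℝ) ≤ m := by exact_mod_cast him
      exact one_div_nonneg.2 (by linarith)
    · simpa using div_nonneg hN m.cast_nonneg
  obtain ⟨y, hy, hmax⟩ := (isCompact_genYset_inter m d N f q).exists_isMaxOn
    ⟨0, hzero, fun _ _ _ => rfl⟩ (continuous_genGfun m d N f c q r).continuousOn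
  refine ⟨y, hy.1, fun y' hy' => ?_⟩
  let t : ℕ → ℕ → ℝ := fun i u =>
    if i ∈ Finset.Icc 1 m ∧ u ∈ Finset.Icc 1 d then y' i u else 0
  have ht : ∀ i ∈ Finset.Icc 1 m, ∀ u ∈ Finset.Icc 1 d, y' i u = t i u :=
    fun i hi u hu => (if_pos ⟨hi, hu⟩).symm
  rw [genGfun_congr ht]
  exact hmax ⟨genYset_congr ht hy', fun i u h => if_neg h⟩

/-- Exchange argument: a maximizer saturates every cell whose value per unit of capacity
exceeds that of some cell in its support. -/
theorem eq_cap_of_isMaxOn {m d : ℕ} {N f c : ℝ} {q r : ℕ → ℝ} (hfN : 0 < f * N)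
    (hq : ∀ u ∈ Finset.Icc 1 d, q (u - 1) < q u) {y : ℕ → ℕ → ℝ}
    (hy : y ∈ genYset m d N f q)
    (hmax : ∀ y' ∈ genYset m d N f q, genGfun m d N f c q r y' ≤ genGfun m d N f c q r y)
    {i j u v : ℕ} (hi : i ∈ Finset.Icc 1 m) (hj : j ∈ Finset.Icc 1 m)
    (hu : u ∈ Finset.Icc 1 d) (hv : v ∈ Finset.Icc 1 d)
    (heff : ((m : ℝ) - i + 1) * (c - r u) < ((m : ℝ) - j + 1) * (c - r v))
    (hpos : 0 < y i u) : y j v = 1 / ((m : ℝ) - j + 1) := by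
  have hyb := (mem_genYset_iff.1 hy).1
  have hys := (mem_genYset_iff.1 hy).2
  have hi' := Finset.mem_Icc.1 hi
  have hj' := Finset.mem_Icc.1 hj
  have hu' := Finset.mem_Icc.1 hu
  have hv' := Finset.mem_Icc.1 hv
  by_contra hne
  have hlt := lt_of_le_of_ne (hyb j hj'.1 hj'.2 v hv'.1 hv'.2).2 hne
  have hwu : 0 < q u - q (u - 1) := sub_pos.2 (hq u hu)
  have hwv : 0 < q v - q (v - 1) := sub_pos.2 (hq v hv)
  have hK : 0 < f * N / m := div_pos hfN (by exact_mod_cast hi'.1.trans hi'.2)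
  obtain ⟨ε, hε, hεu, hεv⟩ : ∃ ε : ℝ, 0 < ε ∧ ε / (q u - q (u - 1)) ≤ y i u ∧
      ε / (q v - q (v - 1)) ≤ 1 / ((m : ℝ) - j + 1) - y j v := by
    refine ⟨min (y i u * (q u - q (u - 1))) ((1 / ((m : ℝ) - j + 1) - y j v) *
      (q v - q (v - 1))), lt_min (mul_pos hpos hwu) (mul_pos (sub_pos.2 hlt) hwv), ?_, ?_⟩
    · exact (div_le_iff₀ hwu).2 (min_le_left _ _)
    · exact (div_le_iff₀ hwv).2 (min_le_right _ _)
  have hsu : 0 < ε / (q u - q (u - 1)) := div_pos hε hwu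
  have hsv : 0 < ε / (q v - q (v - 1)) := div_pos hε hwv
  have hcu : (q u - q (u - 1)) * (ε / (q u - q (u - 1))) = ε := mul_div_cancel₀ ε hwu.ne'
  have hcv : (q v - q (v - 1)) * (ε / (q v - q (v - 1))) = ε := mul_div_cancel₀ ε hwv.ne'
  generalize ε / (q u - q (u - 1)) = t at *
  generalize ε / (q v - q (v - 1)) = s at *
  have hdisj : ¬ (i = j ∧ u = v) := by
    rintro ⟨rfl, rfl⟩
    exact lt_irrefl _ heff
  have hmem : (fun k l => y k l + (if k = j then if l = v then s else 0 else 0)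
      - (if k = i then if l = u then t else 0 else 0)) ∈ genYset m d N f q := by
    rw [mem_genYset_iff]
    constructor
    · intro k hk hkm l hl hld
      have hkl := hyb k hk hkm l hl hld
      by_cases h1 : k = j ∧ l = v
      · obtain ⟨rfl, rfl⟩ := h1
        have h2 : ¬ (k = i ∧ l = u) := fun h => hdisj ⟨h.1.symm, h.2.symm⟩
        simp only [← ite_and, if_neg h2, if_true]
        constructor <;> linarith
      · by_cases h2 : k = i ∧ l = u
        · obtain ⟨rfl, rfl⟩ := h2
          simp only [← ite_and, if_neg h1, if_true]
          constructor <;> linarith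
        · simpa only [← ite_and, if_neg h1, if_neg h2, add_zero, sub_zero] using hkl
    · rw [sum_sum_mul_add_ite_sub_ite (fun _ l => f * N / m * (q l - q (l - 1))) y s t
        hi hj hu hv]
      simp only [mul_assoc, hcu, hcv] at hys ⊢
      linarith
  have hG := hmax _ hmem
  rw [genGfun_eq, genGfun_eq, sum_sum_mul_add_ite_sub_ite (fun k l =>
    ((m : ℝ) - k + 1) * (f * N / m * (q l - q (l - 1)) * (c - r l))) y s t hi hj hu hv] at hG
  have hgain := mul_pos (mul_pos hK hε) (sub_pos.2 heff)
  have e1 : ((m : ℝ) - j + 1) * (f * N / m * (q v - q (v - 1)) * (c - r v)) * s =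
      f * N / m * ε * (((m : ℝ) - j + 1) * (c - r v)) := by
    rw [← hcv]; ring
  have e2 : ((m : ℝ) - i + 1) * (f * N / m * (q u - q (u - 1)) * (c - r u)) * t =
      f * N / m * ε * (((m : ℝ) - i + 1) * (c - r u)) := by
    rw [← hcu]; ring
  simp only [e1, e2] at hG
  linarith

/-- Lemma 3.4: `G` attains its maximum on `Y`, and every maximizer admits integer
thresholds `z_1 ≥ z_2 ≥ ⋯ ≥ z_d` in `{1,…,m}` such that for each `u`,
`y_{i,u} = 1/(m−i+1)` for `i < z_u` and `y_{i,u} = 0` for `i > z_u`. -/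
theorem general_adversary_lp_thresholds (m d : ℕ) (hm : 1 ≤ m) (hd : 1 ≤ d)
    (N f c : ℝ) (hN : 0 < N) (hf : 1 ≤ f)
    (q : ℕ → ℝ) (hq0 : q 0 = 0) (hqd : q d = 1)
    (hqmono : ∀ u, u < d → q u < q (u + 1))
    (r : ℕ → ℝ) (hr1 : r 1 = 0)
    (hrmono : ∀ u, 1 ≤ u → u < d → r u < r (u + 1)) (hrd : r d < c) :
    (∃ y ∈ genYset m d N f q, ∀ y' ∈ genYset m d N f q,
      genGfun m d N f c q r y' ≤ genGfun m d N f c q r y) ∧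
    ∀ y ∈ genYset m d N f q,
      (∀ y' ∈ genYset m d N f q, genGfun m d N f c q r y' ≤ genGfun m d N f c q r y) →
      ∃ z : ℕ → ℕ, (∀ u, 1 ≤ u → u ≤ d → 1 ≤ z u ∧ z u ≤ m) ∧
        (∀ u, 1 ≤ u → u < d → z (u + 1) ≤ z u) ∧
        ∀ u, 1 ≤ u → u ≤ d →
          (∀ i, 1 ≤ i → i < z u → y i u = 1 / ((m : ℝ) - i + 1)) ∧
          (∀ i, z u < i → i ≤ m → y i u = 0) := by
  have hfN : 0 < f * N := mul_pos (by linarith) hN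
  refine ⟨exists_isMaxOn_genGfun m d hN.le f c q r, fun y hy hmax => ?_⟩
  have hq : ∀ u ∈ Finset.Icc 1 d, q (u - 1) < q u := by
    intro u hu
    obtain ⟨h1, h2⟩ := Finset.mem_Icc.1 hu
    have h := hqmono (u - 1) (by omega)
    rwa [Nat.sub_add_cancel h1] at h
  have hr : ∀ u, 1 ≤ u → u ≤ d → r u < c := by
    intro u hu hud
    induction hud using Nat.decreasingInduction with
    | self => exact hrd
    | of_succ k hk ih => exact (hrmono k hu hk).trans (ih (by omega))
  have hexch := @eq_cap_of_isMaxOn m d N f c q r hfN hq y hy hmax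
  have hsupp : ∀ i ∈ Finset.Icc 1 m, ∀ u, 1 ≤ u → u < d → 0 < y i (u + 1) → 0 < y i u := by
    intro i hi u hu hud hpos
    have him : (i : ℝ) ≤ m := by exact_mod_cast (Finset.mem_Icc.1 hi).2
    rw [hexch hi hi (Finset.mem_Icc.2 ⟨by omega, hud⟩) (Finset.mem_Icc.2 ⟨hu, hud.le⟩)
      (mul_lt_mul_of_pos_left (by linarith [hrmono u hu hud]) (by linarith)) hpos]
    exact one_div_pos.2 (by linarith)
  let z : ℕ → ℕ := fun u => max 1 (Nat.findGreatest (fun i => 0 < y i u) m)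
  refine ⟨z, fun u _ _ => ⟨le_max_left _ _, max_le hm (Nat.findGreatest_le m)⟩, ?_, ?_⟩
  · intro u hu hud
    refine max_le (le_max_left _ _) ?_
    rcases Nat.eq_zero_or_pos (Nat.findGreatest (fun i => 0 < y i (u + 1)) m) with h | h
    · rw [h]
      exact Nat.zero_le _
    · have hle := Nat.findGreatest_le (P := fun i => 0 < y i (u + 1)) m
      exact le_max_of_le_right (Nat.le_findGreatest hle (hsupp _ (Finset.mem_Icc.2 ⟨h, hle⟩)
        u hu hud (Nat.findGreatest_of_ne_zero rfl h.ne')))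
  · intro u hu hud
    have hu' : u ∈ Finset.Icc 1 d := Finset.mem_Icc.2 ⟨hu, hud⟩
    constructor
    · intro i hi hiz
      have hlt := (lt_max_iff.1 hiz).resolve_left hi.not_gt
      have hle := Nat.findGreatest_le (P := fun i => 0 < y i u) m
      have hgp := Nat.findGreatest_of_ne_zero (P := fun i => 0 < y i u) (n := m) rfl (by omega)
      refine hexch (Finset.mem_Icc.2 ⟨by omega, hle⟩) (Finset.mem_Icc.2 ⟨hi, by omega⟩) hu' hu'
        (mul_lt_mul_of_pos_right ?_ (sub_pos.2 (hr u hu hud))) hgp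
      have := Nat.cast_lt (α := ℝ).2 hlt
      linarith
    · intro i hzi him
      obtain ⟨h1, h2⟩ := max_lt_iff.1 hzi
      exact le_antisymm (not_lt.1 (Nat.findGreatest_is_greatest h2 him))
        (hy.1 i h1.le him u hu hud).1
end

section
/- Fix an integer d ≥ 1 and reals c, r_1, …, r_d, γ_1, …, γ_d, and q_1, …, q_d, and set q_0 := 0. Then Σ_{u=1}^{d} ( Σ_{j=1}^{d+1−u} (q_j − q_{j−1})·(c − r_j) ) · (Π_{v=1}^{u−1} γ_v) · (1 − γ_u) = Σ_{u=1}^{d} (q_u − q_{u−1})·(c − r_u)·(1 − Π_{v=1}^{d+1−u} γ_v). (The summation identity at the core of Claim 3.6, which shows LB_{m,N}(s) = UB_{m,N}(s)) -/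
theorem sum_Icc_prod_mul_one_sub {R : Type*} [CommRing R] (γ : ℕ → R) (n : ℕ) :
    ∑ u ∈ Finset.Icc 1 n, (∏ v ∈ Finset.Icc 1 (u - 1), γ v) * (1 - γ u)
      = 1 - ∏ v ∈ Finset.Icc 1 n, γ v := by
  induction n with
  | zero => simp
  | succ n ih =>
    rw [Finset.sum_Icc_succ_top (by omega), Finset.prod_Icc_succ_top (by omega), ih,
      Nat.add_sub_cancel]
    ring

/-- The summation identity at the core of Claim 3.6 (showing `LB_{m,N}(s) = UB_{m,N}(s)`):
`Σ_{u=1}^{d} (Σ_{j=1}^{d+1−u} (q_j − q_{j−1})(c − r_j)) · (Π_{v=1}^{u−1} γ_v) · (1 − γ_u)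
 = Σ_{u=1}^{d} (q_u − q_{u−1})(c − r_u) · (1 − Π_{v=1}^{d+1−u} γ_v)`. -/
theorem lb_eq_ub_summation_identity (d : ℕ) (hd : 1 ≤ d) (c : ℝ)
    (r γ q : ℕ → ℝ) (hq0 : q 0 = 0) :
    ∑ u ∈ Finset.Icc 1 d,
        (∑ j ∈ Finset.Icc 1 (d + 1 - u), (q j - q (j - 1)) * (c - r j)) *
          (∏ v ∈ Finset.Icc 1 (u - 1), γ v) * (1 - γ u)
      = ∑ u ∈ Finset.Icc 1 d,
          (q u - q (u - 1)) * (c - r u) * (1 - ∏ v ∈ Finset.Icc 1 (d + 1 - u), γ v) := by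
  simp only [← sum_Icc_prod_mul_one_sub, mul_assoc, Finset.sum_mul, Finset.mul_sum]
  refine Finset.sum_comm' fun u j => ?_
  simp only [Finset.mem_Icc]
  omega
end

section
/- Fix an integer k ≥ 1 and a real f > 0 with f·k ≥ 1, and define ψ(t) := 1 − (1 − 1/(f·k))^{k−t+1} for t ∈ {1,…,k}. Then for every t ∈ {1,…,k}: ψ(t) + (1/(f·k))·Σ_{s=t}^{k} ψ(s) ≥ (k−t+1)/(f·k). (Key inequality in the proof of Theorem A.6, the performance guarantee of the perturbed greedy algorithm for vertex-weighted matching with supply factor f) -/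
/-- The geometric sum of the discretized potential, in closed form. -/
theorem mul_sum_range_one_sub_pow (a : ℝ) (n : ℕ) :
    a * ∑ j ∈ Finset.range n, (1 - (1 - a) ^ (j + 1)) = a * n - (1 - a) * (1 - (1 - a) ^ n) := by
  induction n with
  | zero => simp
  | succ n ih =>
    rw [Finset.sum_range_succ, mul_add, ih]
    push_cast
    ring

theorem sum_Icc_sub_eq_sum_range {M : Type*} [AddCommMonoid M] (g : ℕ → M) (t m : ℕ) :
    ∑ s ∈ Finset.Icc t (t + m), g (t + m - s + 1) = ∑ j ∈ Finset.range (m + 1), g (j + 1) := by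
  rw [← Finset.sum_range_reflect, ← Finset.Ico_add_one_right_eq_Icc,
    Finset.sum_Ico_eq_sum_range, show t + m + 1 - t = m + 1 by omega]
  refine Finset.sum_congr rfl fun i _ => ?_
  congr 1
  omega


/-- Key inequality in the proof of Theorem A.6 for the discretized potential
`ψ(t) = 1 − (1 − 1/(f·k))^{k−t+1}`: for every `t ∈ {1,…,k}`,
`ψ(t) + (1/(f·k))·Σ_{s=t}^{k} ψ(s) ≥ (k−t+1)/(f·k)`. -/
theorem psi_key_inequality (k : ℕ) (hk : 1 ≤ k) (f : ℝ) (hf : 0 < f)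
    (hfk : 1 ≤ f * k) :
    ∀ t ∈ Finset.Icc 1 k,
      (1 - (1 - 1 / (f * k)) ^ (k - t + 1))
        + (1 / (f * k)) * ∑ s ∈ Finset.Icc t k, (1 - (1 - 1 / (f * k)) ^ (k - s + 1))
      ≥ ((k : ℝ) - t + 1) / (f * k) := by
  intro t ht
  obtain ⟨m, rfl⟩ := Nat.exists_eq_add_of_le (Finset.mem_Icc.mp ht).2
  rw [sum_Icc_sub_eq_sum_range (fun j => 1 - (1 - 1 / (f * ((t + m : ℕ) : ℝ))) ^ j),
    mul_sum_range_one_sub_pow, Nat.add_sub_cancel_left, div_eq_mul_one_div (((t + m : ℕ) : ℝ) - t + 1)]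
  have ha0 : 0 ≤ 1 / (f * ((t + m : ℕ) : ℝ)) := by positivity
  have ha1 : 1 / (f * ((t + m : ℕ) : ℝ)) ≤ 1 := div_le_one_of_le₀ hfk (by positivity)
  generalize 1 / (f * ((t + m : ℕ) : ℝ)) = a at ha0 ha1 ⊢
  have hpow : (1 - a) ^ (m + 1) ≤ 1 := pow_le_one₀ (by linarith) (by linarith)
  push_cast
  linarith [mul_nonneg ha0 (sub_nonneg.mpr hpow)]
end

section
/- Fix an integer k ≥ 1 and a real f > 0 with f·k ≥ 1, and define ψ(t) := 1 − (1 − 1/(f·k))^{k−t+1} for t ∈ {1,…,k}. Let α_1, …, α_k ≥ 0 and B ≥ 0 be reals satisfying Σ_{t=1}^{k} α_t·( ψ(t) + (1/(f·k))·Σ_{s=t}^{k} ψ(s) ) ≤ (B/(f·k))·Σ_{t=1}^{k} ψ(t). Then Σ_{t=1}^{k} (k−t+1)·α_t ≤ B·Σ_{t=1}^{k} ψ(t). (The total-loss bound in the proof of Theorem A.6) -/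
/-- Closed form for the reversed partial sums of `1 - q ^ j`, scaled by `1 - q`. -/
theorem one_sub_mul_sum_Icc_one_sub_pow {R : Type*} [CommRing R] (q : R) (k m t : ℕ)
    (h : t + m = k + 1) :
    (1 - q) * ∑ s ∈ Finset.Icc t k, (1 - q ^ (k - s + 1)) = m * (1 - q) - q * (1 - q ^ m) := by
  induction m generalizing t with
  | zero => simp [Finset.Icc_eq_empty (show ¬ t ≤ k by omega)]
  | succ m ih =>
    rw [← Finset.insert_Icc_add_one_left_eq_Icc (show t ≤ k by omega), Finset.sum_insert (by simp), mul_add,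
      ih (t + 1) (by omega), show k - t + 1 = m + 1 by omega]
    push_cast
    ring

/-- The total-loss bound in the proof of Theorem A.6: if `α_t ≥ 0`, `B ≥ 0`, and
`Σ_t α_t·(ψ(t) + (1/(f·k))·Σ_{s≥t} ψ(s)) ≤ (B/(f·k))·Σ_t ψ(t)`, then
`Σ_t (k−t+1)·α_t ≤ B·Σ_t ψ(t)`, where `ψ(t) = 1 − (1 − 1/(f·k))^{k−t+1}`. -/
theorem total_loss_bound (k : ℕ) (hk : 1 ≤ k) (f : ℝ) (hf : 0 < f)
    (hfk : 1 ≤ f * k)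
    (ψ : ℕ → ℝ) (hψ : ∀ t, ψ t = 1 - (1 - 1 / (f * k)) ^ (k - t + 1))
    (α : ℕ → ℝ) (hα : ∀ t ∈ Finset.Icc 1 k, 0 ≤ α t)
    (B : ℝ) (hB : 0 ≤ B)
    (h : ∑ t ∈ Finset.Icc 1 k, α t * (ψ t + (1 / (f * k)) * ∑ s ∈ Finset.Icc t k, ψ s)
        ≤ (B / (f * k)) * ∑ t ∈ Finset.Icc 1 k, ψ t) :
    ∑ t ∈ Finset.Icc 1 k, ((k : ℝ) - t + 1) * α t ≤ B * ∑ t ∈ Finset.Icc 1 k, ψ t := by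
  have hn : 0 < f * k := by linarith
  have hq0 : 0 ≤ 1 - 1 / (f * k) := sub_nonneg.2 ((div_le_one hn).2 hfk)
  have hq1 : 1 - 1 / (f * k) ≤ 1 := sub_le_self _ (by positivity)
  have coeff_le : ∀ t ∈ Finset.Icc 1 k, ((k : ℝ) - t + 1) * (1 / (f * k)) ≤
      ψ t + (1 / (f * k)) * ∑ s ∈ Finset.Icc t k, ψ s := by
    intro t ht
    rw [Finset.mem_Icc] at ht
    have hsum := one_sub_mul_sum_Icc_one_sub_pow (1 - 1 / (f * k)) k (k - t + 1) t (by omega)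
    rw [sub_sub_cancel] at hsum
    simp only [hψ]
    rw [hsum]
    push_cast [ht.2]
    have hpow := pow_le_one₀ hq0 hq1 (n := k - t + 1)
    have hinv : 0 ≤ 1 / (f * k) := by positivity
    nlinarith [mul_nonneg hinv (sub_nonneg.2 hpow)]
  have hle : ∑ t ∈ Finset.Icc 1 k, α t * (((k : ℝ) - t + 1) * (1 / (f * k))) ≤
      (B / (f * k)) * ∑ t ∈ Finset.Icc 1 k, ψ t :=
    (Finset.sum_le_sum fun t ht => mul_le_mul_of_nonneg_left (coeff_le t ht) (hα t ht)).trans h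
  calc ∑ t ∈ Finset.Icc 1 k, ((k : ℝ) - t + 1) * α t
      = (f * k) * ∑ t ∈ Finset.Icc 1 k, α t * (((k : ℝ) - t + 1) * (1 / (f * k))) := by
        rw [Finset.mul_sum]
        exact Finset.sum_congr rfl fun t _ => by field_simp
    _ ≤ (f * k) * ((B / (f * k)) * ∑ t ∈ Finset.Icc 1 k, ψ t) :=
        mul_le_mul_of_nonneg_left hle hn.le
    _ = B * ∑ t ∈ Finset.Icc 1 k, ψ t := by rw [← mul_assoc, mul_div_cancel₀ _ hn.ne']
end

section
/- For every real f ≥ 1 there exists a constant C > 0 (depending only on f) such that for every integer m ≥ 1: Σ_{j=1}^{m} min(1, f·Σ_{i=1}^{j} 1/(m−i+1)) ≤ m·f·(1 − e^{−1/f}) + C. (The counting bound in the tightness proof for online matching with supply factor f, showing no online algorithm exceeds competitive ratio f − f·e^{−1/f} on the upper-triangular instance) -/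
theorem sum_min_one_le (g : ℕ → ℝ) {k n : ℕ} (h : k ≤ n) :
    ∑ j ∈ Finset.Icc 1 n, min 1 (g j) ≤ ∑ j ∈ Finset.Icc 1 k, g j + ((n : ℝ) - k) := by
  induction n, h using Nat.le_induction with
  | base => simpa using Finset.sum_le_sum fun j _ => min_le_right 1 (g j)
  | succ n _ ih =>
    rw [Finset.sum_Icc_succ_top (by lia)]
    push_cast
    linarith [min_le_left 1 (g (n + 1))]

theorem sum_sum_one_div_sub {m k : ℕ} (h : k ≤ m) :
    ∑ j ∈ Finset.Icc 1 k, ∑ i ∈ Finset.Icc 1 j, 1 / ((m : ℝ) - i + 1)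
      = k - ((m : ℝ) - k) * ∑ i ∈ Finset.Icc 1 k, 1 / ((m : ℝ) - i + 1) := by
  induction k with
  | zero => simp
  | succ k ih =>
    have hk : (m : ℝ) - k ≠ 0 := by
      have : (k : ℝ) < m := by exact_mod_cast h
      linarith
    rw [Finset.sum_Icc_succ_top (by lia), ih (by lia), Finset.sum_Icc_succ_top (by lia)]
    push_cast
    rw [show (m : ℝ) - (k + 1) + 1 = m - k by ring]
    field_simp
    ring

theorem log_sub_log_le_sum_one_div_sub {m k : ℕ} (h : k ≤ m) :
    Real.log ((m : ℝ) + 1) - Real.log ((m : ℝ) - k + 1)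
      ≤ ∑ i ∈ Finset.Icc 1 k, 1 / ((m : ℝ) - i + 1) := by
  induction k with
  | zero => simp
  | succ k ih =>
    have hk : 0 < (m : ℝ) - k := by
      have : (k : ℝ) < m := by exact_mod_cast h
      linarith
    rw [Finset.sum_Icc_succ_top (by lia)]
    push_cast
    rw [show (m : ℝ) - (k + 1) + 1 = m - k by ring]
    have hlog := Real.log_le_sub_one_of_pos (show 0 < ((m : ℝ) - k + 1) / (m - k) by positivity)
    rw [Real.log_div (by positivity) hk.ne', add_div, div_self hk.ne'] at hlog
    linarith [ih (by lia)]


/-- The counting bound in the tightness proof for online matching with supply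
factor `f`: there is a constant `C > 0` (depending only on `f`) such that for all
`m ≥ 1`, `Σ_{j=1}^{m} min(1, f·Σ_{i=1}^{j} 1/(m−i+1)) ≤ m·f·(1 − e^{−1/f}) + C`. -/
theorem upper_triangular_counting_bound (f : ℝ) (hf : 1 ≤ f) :
    ∃ C : ℝ, 0 < C ∧ ∀ m : ℕ, 1 ≤ m →
      ∑ j ∈ Finset.Icc 1 m,
          min 1 (f * ∑ i ∈ Finset.Icc 1 j, 1 / ((m : ℝ) - i + 1))
        ≤ m * f * (1 - Real.exp (-1 / f)) + C := by
  set E := Real.exp (-1 / f) with hE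
  have hf0 : 0 < f := by linarith
  have hE0 : 0 < E := Real.exp_pos _
  have hE1 : E ≤ 1 := Real.exp_le_one_iff.2 (by rw [neg_div]; simp; positivity)
  refine ⟨2 * f / E, by positivity, fun m _ => ?_⟩
  have hx : 0 ≤ (m : ℝ) * (1 - E) := mul_nonneg (by positivity) (by linarith)
  obtain ⟨k, hk⟩ : ∃ k, k = ⌊(m : ℝ) * (1 - E)⌋₊ := ⟨_, rfl⟩
  have hk1 : (k : ℝ) ≤ m * (1 - E) := hk ▸ Nat.floor_le hx
  have hk2 : (m : ℝ) * (1 - E) < k + 1 := hk ▸ Nat.lt_floor_add_one _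
  have hm0 : (0 : ℝ) ≤ m := by positivity
  have hkm' : (k : ℝ) ≤ m := by nlinarith
  have hkm : k ≤ m := by exact_mod_cast hkm'
  have hsum := sum_min_one_le (fun j => f * ∑ i ∈ Finset.Icc 1 j, 1 / ((m : ℝ) - i + 1)) hkm
  rw [← Finset.mul_sum, sum_sum_one_div_sub hkm] at hsum
  have hA := log_sub_log_le_sum_one_div_sub hkm
  set A := ∑ i ∈ Finset.Icc 1 k, 1 / ((m : ℝ) - i + 1)
  have hn : 0 < (m : ℝ) - k + 1 := by linarith
  have hlog := Real.log_le_sub_one_of_pos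
    (show 0 < ((m : ℝ) - k + 1) / ((m + 1) * E) by positivity)
  rw [Real.log_div hn.ne' (by positivity), Real.log_mul (by positivity) hE0.ne', hE,
    Real.log_exp, ← hE] at hlog
  have hq : ((m : ℝ) - k + 1) / ((m + 1) * E) - 1 ≤ 2 / ((m + 1) * E) := by
    rw [sub_le_iff_le_add, div_add_one (by positivity)]
    exact div_le_div_of_nonneg_right (by linarith) (by positivity)
  have hdef : 1 - f * A ≤ f * (2 / ((m + 1) * E)) := by
    have : f * (1 / f - A) ≤ f * (2 / ((m + 1) * E)) := by
      gcongr
      rw [neg_div] at hlog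
      linarith
    rwa [mul_sub, mul_one_div_cancel hf0.ne'] at this
  have herr : ((m : ℝ) - k) * (1 - f * A) ≤ 2 * f / E := calc
    ((m : ℝ) - k) * (1 - f * A) ≤ (m + 1) * (f * (2 / ((m + 1) * E))) := by
      refine (mul_le_mul_of_nonneg_left hdef (by linarith)).trans ?_
      gcongr
      linarith [(Nat.cast_nonneg k : (0 : ℝ) ≤ k)]
    _ = 2 * f / E := by field_simp
  have := mul_le_mul_of_nonneg_left hk1 hf0.le
  linarith
end

section
/- Fix reals N > 0, f ≥ 1, q ∈ (0,1), r, c with 0 < r < c, and a real s ∈ [0,1]. For each integer t with q·t·f ≥ 1, let s_t := ⌊s·t⌋ and define β^{(t)}_j := (N/t)·(1 − 1/(t·f))^{j−1} for 1 ≤ j ≤ s_t + 1 and β^{(t)}_j := (N/t)·(1 − 1/(t·f))^{s_t}·(1 − 1/(q·t·f))^{j−s_t−1} for s_t + 1 < j ≤ t. Then the limit as t → ∞ of N·f·(1−q)·r − N·c + (c − (1−q)·r)·Σ_{j=1}^{s_t} β^{(t)}_j + c·Σ_{j=s_t+1}^{t} β^{(t)}_j equals N·c·(f−1) + (1−q)·(r−c)·f·N·e^{−s/f}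 − q·f·N·c·e^{((1−q)/q)·(s/f) − 1/(q·f)}, i.e., RHS(s/f). (The limit computation in the proof of Claim 2.3 evaluating the LP objective at the optimal LP solution β*) -/
/-- A geometric sum with ratio `1 - 1 / u`. -/
theorem sum_range_one_sub_one_div_pow {u : ℝ} (hu : u ≠ 0) (n : ℕ) :
    ∑ i ∈ Finset.range n, (1 - 1 / u) ^ i = u * (1 - (1 - 1 / u) ^ n) := by
  have h := mul_neg_geom_sum (1 - 1 / u) n
  rw [← h, sub_sub_cancel, ← mul_assoc, mul_one_div_cancel hu, one_mul]

/-- If `k t / t → κ`, then `(1 - 1 / (t * a)) ^ k t → exp (-(κ / a))`. -/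
theorem tendsto_one_sub_one_div_mul_pow {a κ : ℝ} (ha : 0 < a) {k : ℕ → ℕ}
    (hk : Filter.Tendsto (fun t : ℕ => (k t : ℝ) / t) Filter.atTop (nhds κ)) :
    Filter.Tendsto (fun t : ℕ => (1 - 1 / ((t : ℝ) * a)) ^ k t) Filter.atTop
      (nhds (Real.exp (-(κ / a)))) := by
  have hbase : Filter.Tendsto (fun t : ℕ => (1 + -(1 / ((t : ℝ) * a))) ^ t) Filter.atTop
      (nhds (Real.exp (-(1 / a)))) := by
    apply Real.tendsto_one_add_pow_exp_of_tendsto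
    refine tendsto_const_nhds.congr' ?_
    filter_upwards [Filter.eventually_gt_atTop 0] with t ht
    have ht' : (0 : ℝ) < t := Nat.cast_pos.2 ht
    field_simp
  have hpow := hbase.rpow hk (Or.inl (Real.exp_pos _).ne')
  rw [← Real.exp_mul, show -(1 / a) * κ = -(κ / a) by ring] at hpow
  refine hpow.congr' ?_
  filter_upwards [Filter.eventually_gt_atTop 0,
    tendsto_natCast_atTop_atTop.eventually_ge_atTop (1 / a)] with t ht hta
  have ht' : (0 : ℝ) < t := Nat.cast_pos.2 ht
  have hnonneg : 0 ≤ 1 + -(1 / ((t : ℝ) * a)) := by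
    have h1 : 1 ≤ (t : ℝ) * a := (div_le_iff₀ ha).1 hta
    have h2 : 1 / ((t : ℝ) * a) ≤ 1 := (div_le_one (by positivity)).2 h1
    linarith
  rw [← Real.rpow_natCast, ← Real.rpow_mul hnonneg, mul_div_cancel₀ _ ht'.ne',
    Real.rpow_natCast, sub_eq_add_neg]

/-- The limit computation in the proof of Claim 2.3: evaluating the binary LP
objective at the optimal LP solution `β^{(t)}` (with threshold index
`s_t = ⌊s·t⌋`) and letting the discretization parameter `t → ∞` yields
`RHS(s/f) = N·c·(f−1) + (1−q)(r−c)·f·N·e^{−s/f} − q·f·N·c·e^{((1−q)/q)(s/f) − 1/(qf)}`. -/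
theorem lp_objective_limit (N f q r c s : ℝ) (hN : 0 < N) (hf : 1 ≤ f)
    (hq0 : 0 < q) (hq1 : q < 1) (hr : 0 < r) (hrc : r < c)
    (hs0 : 0 ≤ s) (hs1 : s ≤ 1) :
    Filter.Tendsto (fun t : ℕ =>
        let st : ℕ := ⌊s * t⌋₊
        let β : ℕ → ℝ := fun j =>
          if j ≤ st + 1 then (N / t) * (1 - 1 / (t * f)) ^ (j - 1)
          else (N / t) * (1 - 1 / (t * f)) ^ st * (1 - 1 / (q * t * f)) ^ (j - st - 1)
        N * f * (1 - q) * r - N * c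
          + (c - (1 - q) * r) * (∑ j ∈ Finset.Icc 1 st, β j)
          + c * ∑ j ∈ Finset.Icc (st + 1) t, β j)
      Filter.atTop
      (nhds (N * c * (f - 1) + (1 - q) * (r - c) * f * N * Real.exp (-(s / f))
        - q * f * N * c * Real.exp (((1 - q) / q) * (s / f) - 1 / (q * f)))) := by
  have hf0 : 0 < f := by linarith
  have hk : Filter.Tendsto (fun t : ℕ => ((⌊s * t⌋₊ : ℕ) : ℝ) / t) Filter.atTop (nhds s) :=
    (tendsto_nat_floor_mul_div_atTop hs0).comp tendsto_natCast_atTop_atTop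
  have hfloor (t : ℕ) : ⌊s * t⌋₊ ≤ t :=
    Nat.floor_le_of_le (mul_le_of_le_one_left (Nat.cast_nonneg t) hs1)
  have hk' : Filter.Tendsto (fun t : ℕ => ((t - ⌊s * t⌋₊ : ℕ) : ℝ) / t) Filter.atTop
      (nhds (1 - s)) := by
    refine (tendsto_const_nhds.sub hk).congr' ?_
    filter_upwards [Filter.eventually_gt_atTop 0] with t ht
    have ht' : (t : ℝ) ≠ 0 := Nat.cast_ne_zero.2 ht.ne'
    rw [Nat.cast_sub (hfloor t), sub_div, div_self ht']
  have hA := tendsto_one_sub_one_div_mul_pow hf0 hk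
  have hB := tendsto_one_sub_one_div_mul_pow (mul_pos hq0 hf0) hk'
  have hlim := ((hA.const_sub 1).const_mul ((c - (1 - q) * r) * (N * f))).const_add
    (N * f * (1 - q) * r - N * c) |>.add ((hA.mul (hB.const_sub 1)).const_mul (c * (N * q * f)))
  have hexp : Real.exp (((1 - q) / q) * (s / f) - 1 / (q * f))
      = Real.exp (-(s / f)) * Real.exp (-((1 - s) / (q * f))) := by
    rw [← Real.exp_add]
    congr 1
    field_simp
    ring
  rw [hexp]
  convert hlim.congr' ?_ using 2
  · ring
  filter_upwards [Filter.eventually_gt_atTop 0] with t ht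
  have ht' : (t : ℝ) ≠ 0 := Nat.cast_ne_zero.2 ht.ne'
  have hu : (t : ℝ) * f ≠ 0 := mul_ne_zero ht' hf0.ne'
  have hv : (t : ℝ) * (q * f) ≠ 0 := mul_ne_zero ht' (mul_pos hq0 hf0).ne'
  have hqtf : q * t * f = t * (q * f) := by ring
  simp only [hqtf]
  generalize ⌊s * t⌋₊ = m
  have hsum₁ : ∑ j ∈ Finset.Icc 1 m, (if j ≤ m + 1 then
        (N / t) * (1 - 1 / (t * f)) ^ (j - 1)
      else (N / t) * (1 - 1 / (t * f)) ^ m * (1 - 1 / (t * (q * f))) ^ (j - m - 1))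
      = N * f * (1 - (1 - 1 / (t * f)) ^ m) := by
    rw [← Finset.Ico_add_one_right_eq_Icc, Finset.sum_Ico_eq_sum_range]
    calc _ = ∑ i ∈ Finset.range m, (N / t) * (1 - 1 / (t * f)) ^ i := by
          refine Finset.sum_congr (by simp) fun i hi => ?_
          have := Finset.mem_range.1 hi
          rw [if_pos (by omega), Nat.add_sub_cancel_left]
      _ = _ := by
          rw [← Finset.mul_sum, sum_range_one_sub_one_div_pow hu]
          field_simp
  have hsum₂ : ∑ j ∈ Finset.Icc (m + 1) t, (if j ≤ m + 1 then
        (N / t) * (1 - 1 / (t * f)) ^ (j - 1)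
      else (N / t) * (1 - 1 / (t * f)) ^ m * (1 - 1 / (t * (q * f))) ^ (j - m - 1))
      = N * q * f * ((1 - 1 / (t * f)) ^ m * (1 - (1 - 1 / (t * (q * f))) ^ (t - m))) := by
    rw [← Finset.Ico_add_one_right_eq_Icc, Finset.sum_Ico_eq_sum_range]
    calc _ = ∑ i ∈ Finset.range (t - m),
            (N / t) * (1 - 1 / (t * f)) ^ m * (1 - 1 / (t * (q * f))) ^ i := by
          refine Finset.sum_congr (by congr 1; omega) fun i _ => ?_
          rcases Nat.eq_zero_or_pos i with rfl | hi
          · simp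
          · rw [if_neg (by omega), show m + 1 + i - m - 1 = i by omega]
      _ = _ := by
          rw [← Finset.mul_sum, sum_range_one_sub_one_div_pow hv]
          generalize (1 - 1 / ((t : ℝ) * f)) ^ m = x
          generalize (1 - 1 / ((t : ℝ) * (q * f))) ^ (t - m) = y
          field_simp
  rw [hsum₁, hsum₂]
  ring
end
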